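/- arXiv:2111.02166 — 2 statements merged into one kernel-verified Lean document; each statement's English description precedes it below -/
import Mathlib

section
/- Let E be a spectral effect algebra, a ∈ E, and let {p_{a,λ}} (λ a dyadic rational in [0,1]) be the binary spectral resolution of a. Then for every C-block C containing a and every dyadic rational λ ∈ [0,1], the rational spectral projection p^C_{a,λ} computed in the universal group of C equals p_{a,λ}; in particular p^C_{a,λ} does not depend on the choice of the C-block C containing a. -/
/- Common definitions: effect algebras, compression bases, spectrality -/

attribute [local instance 0] Classical.propDecidable

universe u

structure EffectAlgebra (E : Type u) where
  padd : E → E → Option E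
  zero : E
  one : E
  comm : ∀ a b, padd a b = padd b a
  assoc : ∀ a b c ab abc, padd a b = some ab → padd ab c = some abc →
      ∃ bc, padd b c = some bc ∧ padd a bc = some abc
  orth_exists : ∀ a, ∃ x, padd a x = some one
  orth_unique : ∀ a x y, padd a x = some one → padd a y = some one → x = y
  add_one : ∀ a b, padd a one = some b → a = zero

namespace EffectAlgebra

variable {E : Type u} (EA : EffectAlgebra E)

/-- `a ⊥ b` and `a ⊕ b = c`. -/
def le (a b : E) : Prop := ∃ c, EA.padd a c = some b

/-- the orthosupplement `a'`. -/
noncomputable def compl (a : E) : E := (EA.orth_exists a).choose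

/-- `b ⊖ a` (the element `c` with `a ⊕ c = b`, when it exists). -/
noncomputable def osub (b a : E) : E :=
  if h : ∃ c, EA.padd a c = some b then h.choose else EA.zero

/-- the value of `a ⊕ b` (defaulting to `0` when undefined). -/
noncomputable def oplusD (a b : E) : E := (EA.padd a b).getD EA.zero

def IsSharp (a : E) : Prop := ∀ x, EA.le x a → EA.le x (EA.compl a) → x = EA.zero

/-- sub-effect algebra. -/
def SubEA (P : Set E) : Prop :=
  EA.zero ∈ P ∧ EA.one ∈ P ∧ (∀ a ∈ P, EA.compl a ∈ P) ∧
    ∀ a ∈ P, ∀ b ∈ P, ∀ c, EA.padd a b = some c → c ∈ P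

/-- Mackey compatibility: `a = a₁ ⊕ c`, `b = b₁ ⊕ c` with `a₁ ⊕ b₁ ⊕ c` defined. -/
def Mackey (a b : E) : Prop :=
  ∃ a1 b1 c d e, EA.padd a1 b1 = some d ∧ EA.padd d c = some e ∧
    EA.padd a1 c = some a ∧ EA.padd b1 c = some b

def Additive (J : E → E) : Prop :=
  ∀ a b c, EA.padd a b = some c → EA.padd (J a) (J b) = some (J c)

def Retraction (J : E → E) : Prop :=
  EA.Additive J ∧ ∀ a, EA.le a (J EA.one) → J a = a

def Compression (J : E → E) : Prop :=
  EA.Retraction J ∧ ∀ a, (J a = EA.zero ↔ EA.le a (EA.compl (J EA.one)))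

/-- `I` is a supplement of `J`: `Ker J = ran I` and `Ker I = ran J`. -/
def Supplement (I J : E → E) : Prop :=
  (∀ a, J a = EA.zero ↔ ∃ b, I b = a) ∧ (∀ a, I a = EA.zero ↔ ∃ b, J b = a)

/-- the `n`-fold sum `n·a`, when defined. -/
def nsmulE : ℕ → E → Option E
  | 0, _ => some EA.zero
  | n + 1, a => (nsmulE n a).bind fun b => EA.padd a b

def ArchimedeanEA : Prop :=
  ∀ a : E, (∀ n : ℕ, ∃ b, EA.nsmulE n a = some b) → a = EA.zero

/-- a state on an effect algebra. -/
def IsState (s : E → ℝ) : Prop :=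
  s EA.one = 1 ∧ (∀ a, 0 ≤ s a ∧ s a ≤ 1) ∧
    ∀ a b c, EA.padd a b = some c → s c = s a + s b

noncomputable def partialSum (f : ℕ → E) : ℕ → E
  | 0 => EA.zero
  | n + 1 => EA.oplusD (partialSum f n) (f n)

/-- σ-additivity of a state: if all partial sums of an orthogonal sequence are defined
and the orthosum (= supremum of the partial sums) exists, the state is countably additive. -/
def SigmaAdditive (s : E → ℝ) : Prop :=
  ∀ f : ℕ → E, ∀ b : E,
    (∀ n, ∃ c, EA.padd (EA.partialSum f n) (f n) = some c) →
    (∀ n, EA.le (EA.partialSum f n) b) →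
    (∀ c, (∀ n, EA.le (EA.partialSum f n) c) → EA.le b c) →
    Filter.Tendsto (fun n => ∑ i ∈ Finset.range n, s (f i)) Filter.atTop (nhds (s b))

/-- A compression base: a family of compressions indexed by a sub-effect algebra `P`
such that each `p ∈ P` is the focus of `J p`, and Mackey compatible projections
compose to a projection. -/
structure CompressionBase {E : Type u} (EA : EffectAlgebra E) where
  P : Set E
  J : E → E → E
  sub : EA.SubEA P
  compr : ∀ p ∈ P, EA.Compression (J p)
  focus : ∀ p ∈ P, J p EA.one = p
  mackey : ∀ p ∈ P, ∀ q ∈ P, EA.Mackey p q → ∃ r ∈ P, J p ∘ J q = J r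

variable (CB : CompressionBase EA)

/-- `a ∈ C(p)`:  `a = J_p(a) ⊕ J_{p'}(a)`. -/
def inC (a p : E) : Prop :=
  EA.padd (CB.J p a) (CB.J (EA.compl p) a) = some a

/-- `PC(a) = {p ∈ P : a ∈ C(p)}`. -/
def PC (a : E) : Set E := {p | p ∈ CB.P ∧ inC EA CB a p}

/-- the bicommutant `P(a)`. -/
def bicomm (a : E) : Set E :=
  {p | p ∈ PC EA CB a ∧ ∀ q ∈ PC EA CB a, inC EA CB p q}

/-- `PC(A)` for a set `A ⊆ E`. -/
def PCset (A : Set E) : Set E := {p | p ∈ CB.P ∧ ∀ a ∈ A, inC EA CB a p}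

/-- `P(Q) = PC(PC(Q) ∪ Q)`. -/
def Pset (Q : Set E) : Set E := PCset EA CB (PCset EA CB Q ∪ Q)

/-- `P_≤(e,f)`. -/
def Ple (e f : E) : Set E :=
  {p | p ∈ Pset EA CB {e, f} ∧ EA.le (CB.J p e) (CB.J p f) ∧
    EA.le (CB.J (EA.compl p) f) (CB.J (EA.compl p) e)}

/-- a Boolean subalgebra of `P`: a sub-effect algebra of `E` contained in `P`
whose elements are pairwise Mackey compatible, with witnesses inside. -/
def BooleanSub (B : Set E) : Prop :=
  B ⊆ CB.P ∧ EA.SubEA B ∧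
    ∀ p ∈ B, ∀ q ∈ B, ∃ p1 ∈ B, ∃ q1 ∈ B, ∃ c ∈ B, ∃ d e,
      EA.padd p1 q1 = some d ∧ EA.padd d c = some e ∧
      EA.padd p1 c = some p ∧ EA.padd q1 c = some q

/-- `a` is a b-element with associated Boolean subalgebra `B`. -/
def IsBElementWith (a : E) (B : Set E) : Prop :=
  BooleanSub EA CB B ∧ ∀ p ∈ CB.P, (inC EA CB a p ↔ ∀ b ∈ B, inC EA CB b p)

def IsBElement (a : E) : Prop := ∃ B, IsBElementWith EA CB a B

def BProperty : Prop := ∀ a : E, IsBElement EA CB a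

/-- commuting of b-elements: `e C f` iff `P(e) ↔ P(f)`. -/
def CommuteEl (e f : E) : Prop :=
  ∀ p ∈ bicomm EA CB e, ∀ q ∈ bicomm EA CB f, EA.Mackey p q

def BComparability : Prop :=
  BProperty EA CB ∧ ∀ e f : E, CommuteEl EA CB e f → (Ple EA CB e f).Nonempty

def IsProjCover (a p : E) : Prop :=
  p ∈ CB.P ∧ ∀ q ∈ CB.P, (EA.le a q ↔ EA.le p q)

def ProjCoverProp : Prop := ∀ a : E, ∃ p, IsProjCover EA CB a p

def Spectral : Prop := ProjCoverProp EA CB ∧ BComparability EA CB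

/-- a block of `P`: a maximal set of pairwise Mackey compatible projections. -/
def IsBlock (B : Set E) : Prop :=
  B ⊆ CB.P ∧ (∀ p ∈ B, ∀ q ∈ B, EA.Mackey p q) ∧
    ∀ B' : Set E, B' ⊆ CB.P → (∀ p ∈ B', ∀ q ∈ B', EA.Mackey p q) → B ⊆ B' → B' = B

/-- the C-block `C(B)`. -/
def Cblock (B : Set E) : Set E := {a | ∀ p ∈ B, inC EA CB a p}

/-- `(f − e)_+` (the positive part, defined when `P_≤(e,f)` is nonempty). -/
noncomputable def posPart (e f : E) : E :=
  if h : (Ple EA CB e f).Nonempty then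
    EA.osub (CB.J h.some f) (CB.J h.some e)
  else EA.zero

noncomputable def projCover (a : E) : E :=
  if h : ∃ p, IsProjCover EA CB a p then h.choose else EA.zero

def IsMeetP (p q m : E) : Prop :=
  m ∈ CB.P ∧ EA.le m p ∧ EA.le m q ∧ ∀ s ∈ CB.P, EA.le s p → EA.le s q → EA.le s m

/-- `p ∧ q` in `P`. -/
noncomputable def pmeet (p q : E) : E :=
  if h : ∃ m, IsMeetP EA CB p q m then h.choose else EA.zero

/-- infimum of a set of projections in `P`. -/
def IsInfP (S : Set E) (m : E) : Prop :=
  m ∈ CB.P ∧ (∀ s ∈ S, EA.le m s) ∧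
    ∀ t ∈ CB.P, (∀ s ∈ S, EA.le t s) → EA.le t m

/-! Relative (to a projection `q`, i.e. computed in the interval `[0,q]`) notions. -/

def Pq (q : E) : Set E := {p | p ∈ CB.P ∧ EA.le p q}

def inCq (q a p : E) : Prop :=
  EA.padd (CB.J p a) (CB.J (EA.osub q p) a) = some a

def PCq (q a : E) : Set E := {p | p ∈ Pq EA CB q ∧ inCq EA CB q a p}

def bicommq (q a : E) : Set E :=
  {p | p ∈ PCq EA CB q a ∧ ∀ r ∈ PCq EA CB q a, inCq EA CB q p r}

def PCsetq (q : E) (A : Set E) : Set E :=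
  {p | p ∈ Pq EA CB q ∧ ∀ a ∈ A, inCq EA CB q a p}

def Psetq (q : E) (Q : Set E) : Set E := PCsetq EA CB q (PCsetq EA CB q Q ∪ Q)

def Pleq (q e f : E) : Set E :=
  {p | p ∈ Psetq EA CB q {e, f} ∧ EA.le (CB.J p e) (CB.J p f) ∧
    EA.le (CB.J (EA.osub q p) f) (CB.J (EA.osub q p) e)}

noncomputable def posPartq (q e f : E) : E :=
  if h : (Pleq EA CB q e f).Nonempty then
    EA.osub (CB.J h.some f) (CB.J h.some e)
  else EA.zero

def IsProjCoverq (q a p : E) : Prop :=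
  p ∈ Pq EA CB q ∧ ∀ s ∈ Pq EA CB q, (EA.le a s ↔ EA.le p s)

noncomputable def projCoverq (q a : E) : E :=
  if h : ∃ p, IsProjCoverq EA CB q a p then h.choose else EA.zero

def Mackeyq (q a b : E) : Prop :=
  ∃ a1 b1 c d e, EA.padd a1 b1 = some d ∧ EA.padd d c = some e ∧ EA.le e q ∧
    EA.padd a1 c = some a ∧ EA.padd b1 c = some b

def SubEAq (q : E) (F : Set E) : Prop :=
  EA.zero ∈ F ∧ q ∈ F ∧ (∀ x ∈ F, EA.osub q x ∈ F) ∧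
    ∀ x ∈ F, ∀ y ∈ F, ∀ z, EA.padd x y = some z → EA.le z q → z ∈ F

def BooleanSubq (q : E) (B : Set E) : Prop :=
  B ⊆ Pq EA CB q ∧ SubEAq EA q B ∧
    ∀ p ∈ B, ∀ r ∈ B, ∃ p1 ∈ B, ∃ r1 ∈ B, ∃ c ∈ B, ∃ d e,
      EA.padd p1 r1 = some d ∧ EA.padd d c = some e ∧ EA.le e q ∧
      EA.padd p1 c = some p ∧ EA.padd r1 c = some r

def IsBElementq (q a : E) : Prop :=
  ∃ B, BooleanSubq EA CB q B ∧
    ∀ p ∈ Pq EA CB q, (inCq EA CB q a p ↔ ∀ b ∈ B, inCq EA CB q b p)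

def BPropertyq (q : E) : Prop := ∀ a : E, EA.le a q → IsBElementq EA CB q a

def CommuteElq (q e f : E) : Prop :=
  ∀ p ∈ bicommq EA CB q e, ∀ r ∈ bicommq EA CB q f, Mackeyq EA q p r

def BComparabilityq (q : E) : Prop :=
  BPropertyq EA CB q ∧ ∀ e f : E, EA.le e q → EA.le f q →
    CommuteElq EA CB q e f → (Pleq EA CB q e f).Nonempty

/-! The binary spectral resolution. -/

/-- `λ(w) = Σ_j w_j 2^{-j}` (head of the list is the first digit). -/
def lamOf : List Bool → ℚ
  | [] => 0
  | b :: t => ((if b then 1 else 0) + lamOf t) / 2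

/-- all binary strings of length `n`, in lexicographic order. -/
def allStrings : ℕ → List (List Bool)
  | 0 => [[]]
  | n + 1 => (allStrings n).flatMap fun w => [w ++ [false], w ++ [true]]

noncomputable def listSum (l : List E) : E :=
  l.foldl (fun acc x => EA.oplusD acc x) EA.zero

/-- the families `(u_w, c_w)`; the binary string is given in reversed order
(head of the list is the last digit). -/
noncomputable def ucAux (a : E) : List Bool → E × E
  | [] => (projCover EA CB a, a)
  | bit :: t =>
      let p := ucAux a t
      let q := p.1
      let cw := p.2
      let cw' := EA.osub q cw
      let d := posPartq EA CB q cw' cw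
      let u0 := pmeet EA CB (EA.osub q (projCoverq EA CB q d)) q
      if bit then (pmeet EA CB q (EA.compl u0), d)
      else (u0, EA.oplusD (CB.J u0 cw) (CB.J u0 cw))

noncomputable def uw (a : E) (w : List Bool) : E := (ucAux EA CB a w.reverse).1

noncomputable def cw (a : E) (w : List Bool) : E := (ucAux EA CB a w.reverse).2

/-- the binary spectral projection `p_{a,λ(w1)}`. -/
noncomputable def pbin (a : E) (w : List Bool) : E :=
  listSum EA (EA.compl (projCover EA CB a) ::
    (((allStrings (w.length + 1)).filter
        fun v => lamOf v ≤ lamOf (w ++ [false])).map (uw EA CB a)))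

def Dyadic01 (x : ℚ) : Prop := ∃ n k : ℕ, (k : ℚ) ≤ 2 ^ n ∧ x = (k : ℚ) / 2 ^ n

/-- the binary spectral resolution `p_{a,λ}`, for dyadic rationals `λ ∈ [0,1]`. -/
noncomputable def pdyad (a : E) (x : ℚ) : E :=
  if x ≤ 0 then EA.compl (projCover EA CB a)
  else if 1 ≤ x then EA.one
  else if h : ∃ w : List Bool, lamOf (w ++ [true]) = x then pbin EA CB a h.choose
  else EA.zero

/-- the rational spectral resolution `p_{a,λ} = ⋀_{μ > λ, μ dyadic} p_{a,μ}`. -/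
noncomputable def ratRes (a : E) (x : ℚ) : E :=
  if h : ∃ m, IsInfP EA CB {y | ∃ μ, Dyadic01 μ ∧ x < μ ∧ y = pdyad EA CB a μ} m
  then h.choose else EA.zero

/-- the partial maps `f_0(b) = 2b`, `f_1(b) = (2b')'` computed in `[0,uu]`. -/
noncomputable def fstep (uu b : E) (bit : Bool) : Option E :=
  if bit then
    (if EA.le (EA.osub uu b) b
      then some (EA.osub uu (EA.oplusD (EA.osub uu b) (EA.osub uu b))) else none)
  else
    (if EA.le b (EA.osub uu b) then some (EA.oplusD b b) else none)

/-- `f_w = f_{w_n} ∘ ⋯ ∘ f_{w_1}`, computed in `[0,uu]`, as a partial map. -/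
noncomputable def fword (uu : E) (w : List Bool) (b : E) : Option E :=
  w.foldl (fun ob bit => ob.bind fun x => fstep EA uu x bit) (some b)

end EffectAlgebra

namespace EffectAlgebra

section Basics

variable {E : Type u} (EA : EffectAlgebra E)

theorem hp_compl_spec (a : E) : EA.padd a (EA.compl a) = some EA.one :=
  (EA.orth_exists a).choose_spec

theorem hp_compl_unique {a x : E} (h : EA.padd a x = some EA.one) : x = EA.compl a :=
  EA.orth_unique a x _ h (hp_compl_spec EA a)

theorem hp_compl_compl (a : E) : EA.compl (EA.compl a) = a :=
  (hp_compl_unique EA (by rw [EA.comm]; exact hp_compl_spec EA a)).symm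

theorem hp_one_zero : EA.padd EA.one EA.zero = some EA.one := by
  obtain ⟨x, hx⟩ := EA.orth_exists EA.one
  have hx2 := hx
  rw [EA.comm] at hx
  have := EA.add_one x _ hx
  rw [this] at hx2; exact hx2

theorem hp_compl_one : EA.compl EA.one = EA.zero := (hp_compl_unique EA (hp_one_zero EA)).symm
theorem hp_compl_zero : EA.compl EA.zero = EA.one := by
  rw [← hp_compl_one, hp_compl_compl]

theorem hp_add_zero (a : E) : EA.padd a EA.zero = some a := by
  have key : ∀ b, EA.padd (EA.compl b) EA.zero = some (EA.compl b) := by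
    intro b
    obtain ⟨bc, h1, h2⟩ := EA.assoc _ _ _ _ _ (hp_compl_spec EA b) (hp_one_zero EA)
    rw [h1, hp_compl_unique EA h2]
  have := key (EA.compl a)
  rwa [hp_compl_compl] at this

theorem hp_zero_add (a : E) : EA.padd EA.zero a = some a := by
  rw [EA.comm, hp_add_zero]

theorem hp_assoc' {a b c bc abc : E} (h1 : EA.padd b c = some bc) (h2 : EA.padd a bc = some abc) :
    ∃ ab, EA.padd a b = some ab ∧ EA.padd ab c = some abc := by
  rw [EA.comm] at h1 h2
  obtain ⟨ab, h3, h4⟩ := EA.assoc _ _ _ _ _ h1 h2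
  rw [EA.comm] at h3 h4
  exact ⟨ab, h3, h4⟩

/-- total sum on `Option E` -/
def hpOadd (x y : Option E) : Option E := x.bind fun a => y.bind fun b => EA.padd a b

theorem hp_oadd_some (a b : E) : hpOadd EA (some a) (some b) = EA.padd a b := rfl

theorem hp_oadd_comm (x y : Option E) : hpOadd EA x y = hpOadd EA y x := by
  cases x <;> cases y <;> simp [hpOadd, EA.comm]

theorem hp_oadd_assoc (x y z : Option E) :
    hpOadd EA (hpOadd EA x y) z = hpOadd EA x (hpOadd EA y z) := by
  rcases x with _ | a
  · rfl
  rcases y with _ | b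
  · rfl
  rcases z with _ | c
  · simp [hpOadd]
  ext t
  constructor
  · intro h
    simp only [hp_oadd_some] at h
    rcases hab : EA.padd a b with _ | ab
    · simp [hab, hpOadd] at h
    · rw [hab] at h
      obtain ⟨bc, h1, h2⟩ := EA.assoc _ _ _ _ _ hab h
      rw [hp_oadd_some, h1]; exact h2
  · intro h
    simp only [hp_oadd_some] at h
    rcases hbc : EA.padd b c with _ | bc
    · simp [hbc, hpOadd] at h
    · rw [hbc] at h
      obtain ⟨bc, h1, h2⟩ := hp_assoc' EA hbc h
      rw [hp_oadd_some, h1]; exact h2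

theorem hp_four {x1 x2 x y1 y2 y z : E} (hx : EA.padd x1 x2 = some x) (hy : EA.padd y1 y2 = some y)
    (hz : EA.padd x y = some z) :
    ∃ s t, EA.padd x1 y1 = some s ∧ EA.padd x2 y2 = some t ∧ EA.padd s t = some z := by
  have h : hpOadd EA (hpOadd EA (some x1) (some y1)) (hpOadd EA (some x2) (some y2)) = some z := by
    rw [← hz, ← hp_oadd_some, ← hx, ← hy, ← hp_oadd_some, ← hp_oadd_some]
    rw [hp_oadd_assoc, hp_oadd_assoc, ← hp_oadd_assoc EA (some y1), ← hp_oadd_assoc EA (some x2),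
      hp_oadd_comm EA (some y1)]
  simp only [hp_oadd_some] at h
  rcases hs : EA.padd x1 y1 with _ | s
  · simp [hs, hpOadd] at h
  rcases ht : EA.padd x2 y2 with _ | t
  · simp [ht, hpOadd] at h
  exact ⟨s, t, rfl, rfl, by rw [hs, ht] at h; exact h⟩

theorem hp_cancel {a b c z : E} (h1 : EA.padd a b = some z) (h2 : EA.padd a c = some z) : b = c := by
  have h3 := hp_compl_spec EA z
  rw [EA.comm] at h3
  obtain ⟨ab, e1, e2⟩ := hp_assoc' EA h1 h3
  obtain ⟨ac, f1, f2⟩ := hp_assoc' EA h2 h3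
  rw [e1] at f1
  cases f1
  exact EA.orth_unique _ _ _ e2 f2

theorem hp_zero_of_sum {a b : E} (h : EA.padd a b = some EA.zero) : a = EA.zero := by
  obtain ⟨x, h1, h2⟩ := EA.assoc _ _ _ _ _ h (hp_zero_add EA EA.one)
  have := EA.add_one _ _ h1
  subst this
  rw [hp_zero_add] at h1; cases h1
  exact EA.add_one _ _ h2

theorem hp_le_refl (a : E) : EA.le a a := ⟨_, hp_add_zero EA a⟩
theorem hp_zero_le (a : E) : EA.le EA.zero a := ⟨_, hp_zero_add EA a⟩
theorem hp_le_one (a : E) : EA.le a EA.one := ⟨_, hp_compl_spec EA a⟩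
theorem hp_le_trans {a b c : E} (h1 : EA.le a b) (h2 : EA.le b c) : EA.le a c := by
  obtain ⟨x, hx⟩ := h1
  obtain ⟨y, hy⟩ := h2
  obtain ⟨t, _, h⟩ := EA.assoc _ _ _ _ _ hx hy
  exact ⟨t, h⟩
theorem hp_le_antisymm {a b : E} (h1 : EA.le a b) (h2 : EA.le b a) : a = b := by
  obtain ⟨x, hx⟩ := h1
  obtain ⟨y, hy⟩ := h2
  obtain ⟨t, h3, h⟩ := EA.assoc _ _ _ _ _ hx hy
  have := hp_cancel EA h (hp_add_zero EA a)
  subst this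
  have := hp_zero_of_sum EA h3
  subst this
  rw [hp_add_zero] at hx; cases hx; rfl

theorem hp_le_zero {a : E} (h : EA.le a EA.zero) : a = EA.zero :=
  hp_le_antisymm EA h (hp_zero_le EA a)

theorem hp_le_left {a b c : E} (h : EA.padd a b = some c) : EA.le a c := ⟨_, h⟩
theorem hp_le_right {a b c : E} (h : EA.padd a b = some c) : EA.le b c := ⟨a, by rw [EA.comm]; exact h⟩

theorem hp_osub_spec {a b : E} (h : EA.le a b) : EA.padd a (EA.osub b a) = some b := by
  have h' : ∃ c, EA.padd a c = some b := h
  unfold osub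
  rw [dif_pos h']; exact h'.choose_spec

theorem hp_osub_eq {a b c : E} (h : EA.padd a c = some b) : EA.osub b a = c :=
  hp_cancel EA (hp_osub_spec EA ⟨c, h⟩) h

/-- `a ⊥ b` iff `b ≤ a'`. -/
theorem hp_orth_le {a b c : E} (h : EA.padd a b = some c) : EA.le b (EA.compl a) := by
  obtain ⟨t, h1, h2⟩ := EA.assoc _ _ _ _ _ h (hp_compl_spec EA c)
  rw [← hp_compl_unique EA h2]; exact ⟨_, h1⟩

theorem hp_le_orth {a b : E} (h : EA.le b (EA.compl a)) : ∃ c, EA.padd a b = some c := by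
  obtain ⟨t, ht⟩ := h
  obtain ⟨c, hc, _⟩ := hp_assoc' EA ht (hp_compl_spec EA a)
  exact ⟨c, hc⟩

theorem hp_compl_anti {a b : E} (h : EA.le a b) : EA.le (EA.compl b) (EA.compl a) := by
  obtain ⟨c, hc⟩ := h
  obtain ⟨t, h1, h2⟩ := EA.assoc _ _ _ _ _ hc (hp_compl_spec EA b)
  rw [← hp_compl_unique EA h2]; exact hp_le_right EA h1

theorem hp_le_compl_comm {a b : E} (h : EA.le a (EA.compl b)) : EA.le b (EA.compl a) := by
  have := hp_compl_anti EA h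
  rwa [hp_compl_compl] at this

theorem hp_mackey_symm {a b : E} (h : EA.Mackey a b) : EA.Mackey b a := by
  obtain ⟨a1, b1, c, d, e, h1, h2, h3, h4⟩ := h
  exact ⟨b1, a1, c, d, e, by rw [EA.comm]; exact h1, h2, h4, h3⟩

theorem hp_mackey_refl (a : E) : EA.Mackey a a :=
  ⟨EA.zero, EA.zero, a, EA.zero, a, hp_zero_add EA _, hp_zero_add EA _, hp_zero_add EA _,
    hp_zero_add EA _⟩

end Basics

section Comp

variable {E : Type u} {EA : EffectAlgebra E} (CB : CompressionBase EA)

theorem hp_Pcompl {p : E} (hp : p ∈ CB.P) : EA.compl p ∈ CB.P := CB.sub.2.2.1 p hp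
theorem hp_P0 : EA.zero ∈ CB.P := CB.sub.1
theorem hp_P1 : EA.one ∈ CB.P := CB.sub.2.1
theorem hp_Padd {p q r : E} (hp : p ∈ CB.P) (hq : q ∈ CB.P) (h : EA.padd p q = some r) :
    r ∈ CB.P := CB.sub.2.2.2 p hp q hq r h

theorem hp_Jadd {p : E} (hp : p ∈ CB.P) {a b c : E} (h : EA.padd a b = some c) :
    EA.padd (CB.J p a) (CB.J p b) = some (CB.J p c) := (CB.compr p hp).1.1 a b c h

theorem hp_Jfix {p : E} (hp : p ∈ CB.P) {a : E} (h : EA.le a p) : CB.J p a = a := by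
  apply (CB.compr p hp).1.2
  rwa [CB.focus p hp]

theorem hp_Jzero_iff {p : E} (hp : p ∈ CB.P) {a : E} : CB.J p a = EA.zero ↔ EA.le a (EA.compl p) := by
  have := (CB.compr p hp).2 a
  rwa [CB.focus p hp] at this

theorem hp_Jmono {p : E} (hp : p ∈ CB.P) {a b : E} (h : EA.le a b) : EA.le (CB.J p a) (CB.J p b) := by
  obtain ⟨c, hc⟩ := h
  exact ⟨_, hp_Jadd CB hp hc⟩

theorem hp_Jle {p : E} (hp : p ∈ CB.P) (a : E) : EA.le (CB.J p a) p := by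
  have := hp_Jmono CB hp (hp_le_one EA a)
  rwa [CB.focus p hp] at this

theorem hp_Jidem {p : E} (hp : p ∈ CB.P) (a : E) : CB.J p (CB.J p a) = CB.J p a :=
  hp_Jfix CB hp (hp_Jle CB hp a)

theorem hp_Jcompl_zero {p : E} (hp : p ∈ CB.P) {a : E} (h : EA.le a p) :
    CB.J (EA.compl p) a = EA.zero := by
  rw [hp_Jzero_iff CB (hp_Pcompl CB hp), hp_compl_compl]; exact h

theorem hp_inC_of_le {p a : E} (hp : p ∈ CB.P) (h : EA.le a p) : inC EA CB a p := by
  unfold inC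
  rw [hp_Jfix CB hp h, hp_Jcompl_zero CB hp h, hp_add_zero]

theorem hp_inC_compl {p a : E} (h : inC EA CB a p) : inC EA CB a (EA.compl p) := by
  unfold inC at *
  rw [hp_compl_compl, EA.comm]; exact h

/-- any decomposition along `p, p'` is the compression decomposition. -/
theorem hp_decomp {p a x y : E} (hp : p ∈ CB.P) (hx : EA.le x p) (hy : EA.le y (EA.compl p))
    (h : EA.padd x y = some a) : CB.J p a = x ∧ CB.J (EA.compl p) a = y := by
  have h1 := hp_Jadd CB hp h
  have h2 := hp_Jadd CB (hp_Pcompl CB hp) h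
  rw [hp_Jfix CB hp hx, (hp_Jzero_iff CB hp).2 hy, hp_add_zero] at h1
  rw [hp_Jfix CB (hp_Pcompl CB hp) hy, hp_Jcompl_zero CB hp hx, hp_zero_add] at h2
  cases h1; cases h2
  constructor <;> simp_all

theorem hp_inC_of_decomp {p a x y : E} (hp : p ∈ CB.P) (hx : EA.le x p) (hy : EA.le y (EA.compl p))
    (h : EA.padd x y = some a) : inC EA CB a p := by
  obtain ⟨h1, h2⟩ := hp_decomp CB hp hx hy h
  unfold inC; rw [h1, h2, h]

theorem hp_mackey_of_inC {p a : E} (hp : p ∈ CB.P) (h : inC EA CB a p) : EA.Mackey p a := by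
  unfold inC at h
  obtain ⟨x, hx⟩ := hp_Jle CB hp a
  obtain ⟨e, he⟩ := hp_le_orth EA (hp_Jle CB (hp_Pcompl CB hp) a)
  rw [EA.comm] at hx
  rw [EA.comm] at he
  obtain ⟨d, h1, h2⟩ := hp_assoc' EA hx he
  refine ⟨x, CB.J (EA.compl p) a, CB.J p a, d, e, by rw [EA.comm]; exact h1, h2, hx,
    by rw [EA.comm]; exact h⟩

theorem hp_inC_of_mackey {p a : E} (hp : p ∈ CB.P) (h : EA.Mackey p a) :
    inC EA CB a p ∧ ∃ b, EA.padd (CB.J p a) b = some p ∧ EA.le b (EA.compl a) := by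
  obtain ⟨a1, b1, c, d, e, h1, h2, h3, h4⟩ := h
  rw [EA.comm] at h1
  obtain ⟨t, h5, h6⟩ := EA.assoc _ _ _ _ _ h1 h2
  rw [h3] at h5; cases h5
  rw [EA.comm] at h6
  have h7 := hp_orth_le EA h6
  rw [EA.comm] at h4
  have h8 : EA.le c p := hp_le_right EA h3
  refine ⟨hp_inC_of_decomp CB hp h8 h7 h4, a1, ?_, ?_⟩
  · rw [(hp_decomp CB hp h8 h7 h4).1, EA.comm]; exact h3
  · rw [EA.comm] at h1
    obtain ⟨t, h5, h6⟩ := EA.assoc _ _ _ _ _ h1 h2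
    rw [EA.comm] at h5
    rw [h4] at h5; cases h5
    rw [EA.comm] at h6
    exact hp_orth_le EA h6

theorem hp_inC_symm {p q : E} (hp : p ∈ CB.P) (hq : q ∈ CB.P) (h : inC EA CB q p) :
    inC EA CB p q :=
  (hp_inC_of_mackey CB hq (hp_mackey_symm EA (hp_mackey_of_inC CB hp h))).1

/-- for commuting projections, `J_p q = J_q p`. -/
theorem hp_meet_comm {p q : E} (hp : p ∈ CB.P) (hq : q ∈ CB.P) (h : inC EA CB q p) :
    CB.J p q = CB.J q p := by
  obtain ⟨b, h1, h2⟩ := (hp_inC_of_mackey CB hp (hp_mackey_of_inC CB hp h)).2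
  refine ((hp_decomp CB hq ?_ h2 h1).1).symm
  exact hp_le_left EA h

theorem hp_JJ {p q : E} (hp : p ∈ CB.P) (hq : q ∈ CB.P) (h : inC EA CB q p) :
    CB.J p q ∈ CB.P ∧ ∀ x, CB.J p (CB.J q x) = CB.J (CB.J p q) x := by
  obtain ⟨r, hr, h1⟩ := CB.mackey p hp q hq (hp_mackey_of_inC CB hp h)
  have h2 : r = CB.J p q := by
    rw [← CB.focus r hr, ← h1, Function.comp, CB.focus q hq]
  subst h2
  exact ⟨hr, fun x => congrFun h1 x⟩

theorem hp_JJcomm {p q : E} (hp : p ∈ CB.P) (hq : q ∈ CB.P) (h : inC EA CB q p) (x : E) :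
    CB.J p (CB.J q x) = CB.J q (CB.J p x) := by
  rw [(hp_JJ CB hp hq h).2, (hp_JJ CB hq hp (hp_inC_symm CB hp hq h)).2, hp_meet_comm CB hp hq h]

theorem hp_inC_add {p x y z : E} (hp : p ∈ CB.P) (hx : inC EA CB x p) (hy : inC EA CB y p)
    (h : EA.padd x y = some z) : inC EA CB z p := by
  obtain ⟨s, t, h1, h2, h3⟩ := hp_four EA hx hy h
  rw [hp_Jadd CB hp h] at h1
  rw [hp_Jadd CB (hp_Pcompl CB hp) h] at h2
  cases h1; cases h2; exact h3

theorem hp_inC_sub {p x y z : E} (hp : p ∈ CB.P) (hx : inC EA CB x p) (hz : inC EA CB z p)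
    (h : EA.padd x y = some z) : inC EA CB y p := by
  obtain ⟨s, t, h1, h2, h3⟩ := hp_four EA (hp_Jadd CB hp h) (hp_Jadd CB (hp_Pcompl CB hp) h) hz
  unfold inC at hx
  rw [hx] at h1; cases h1
  have := hp_cancel EA h h3
  subst this; exact h2

theorem hp_inC_J {p q x : E} (hp : p ∈ CB.P) (hq : q ∈ CB.P) (h : inC EA CB q p)
    (hx : inC EA CB x q) : inC EA CB (CB.J p x) q := by
  have h1 := hp_Jadd CB hp hx
  unfold inC
  rw [← hp_JJcomm CB hp hq h, ← hp_JJcomm CB hp (hp_Pcompl CB hq)]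
  · exact h1
  · exact hp_inC_symm CB (hp_Pcompl CB hq) hp (hp_inC_compl CB (hp_inC_symm CB hp hq h))

theorem hp_osub_P {p q : E} (hp : p ∈ CB.P) (hq : q ∈ CB.P) (h : EA.le p q) :
    EA.osub q p = CB.J q (EA.compl p) ∧ EA.osub q p ∈ CB.P := by
  have h1 := hp_Jadd CB hq (hp_compl_spec EA p)
  rw [hp_Jfix CB hq h, CB.focus q hq] at h1
  rw [hp_osub_eq EA h1]
  refine ⟨rfl, (hp_JJ CB hq (hp_Pcompl CB hp) ?_).1⟩
  exact hp_inC_symm CB (hp_Pcompl CB hp) hq (hp_inC_compl CB (hp_inC_symm CB hq hp (hp_inC_of_le CB hq h)))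

/-- `J_p J_q = J_q J_p = J_p` for `p ≤ q`. -/
theorem hp_JJ_le {p q : E} (hp : p ∈ CB.P) (hq : q ∈ CB.P) (h : EA.le p q) (x : E) :
    CB.J p (CB.J q x) = CB.J p x := by
  have hc := hp_inC_symm CB hq hp (hp_inC_of_le CB hq h)
  rw [(hp_JJ CB hp hq hc).2, hp_meet_comm CB hp hq hc, hp_Jfix CB hq h]

/-- `J_{p'} J_q = J_{q ⊖ p}` for `p ≤ q`. -/
theorem hp_Josub {p q : E} (hp : p ∈ CB.P) (hq : q ∈ CB.P) (h : EA.le p q) (x : E) :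
    CB.J (EA.osub q p) x = CB.J (EA.compl p) (CB.J q x) := by
  have hc : inC EA CB q p := hp_inC_symm CB hq hp (hp_inC_of_le CB hq h)
  have hc' := hp_inC_compl CB hc
  rw [(hp_JJ CB (hp_Pcompl CB hp) hq hc').2, hp_meet_comm CB (hp_Pcompl CB hp) hq hc',
    (hp_osub_P CB hp hq h).1]

/-- relative commutation is commutation -/
theorem hp_inCq_iff {p q x : E} (hp : p ∈ CB.P) (hq : q ∈ CB.P) (h : EA.le p q) (hx : EA.le x q) :
    inCq EA CB q x p ↔ inC EA CB x p := by
  unfold inCq inC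
  rw [hp_Josub CB hp hq h, hp_Jfix CB hq hx]

/-- projections are principal -/
theorem hp_principal {p x y z : E} (hp : p ∈ CB.P) (hx : EA.le x p) (hy : EA.le y p)
    (h : EA.padd x y = some z) : EA.le z p := by
  have h1 := hp_Jadd CB hp h
  rw [hp_Jfix CB hp hx, hp_Jfix CB hp hy, h] at h1
  have h2 : z = CB.J p z := by simpa using h1
  rw [h2]; exact hp_Jle CB hp z

theorem hp_self_orth {p : E} (hp : p ∈ CB.P) (h : EA.le p (EA.compl p)) : p = EA.zero := by
  rw [← (hp_Jzero_iff CB hp).2 h, hp_Jfix CB hp (hp_le_refl EA p)]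

theorem hp_cover_spec (hpc : ProjCoverProp EA CB) (a : E) :
    IsProjCover EA CB a (projCover EA CB a) := by
  unfold projCover
  rw [dif_pos (hpc a)]; exact (hpc a).choose_spec

theorem hp_cover_le (hpc : ProjCoverProp EA CB) (a : E) : EA.le a (projCover EA CB a) := by
  have h := hp_cover_spec CB hpc a
  exact (h.2 _ h.1).2 (hp_le_refl EA _)

theorem hp_cover_inC (hpc : ProjCoverProp EA CB) {a q : E} (hq : q ∈ CB.P) (h : inC EA CB a q) :
    inC EA CB (projCover EA CB a) q := by
  have hr := hp_cover_spec CB hpc (CB.J q a)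
  have hs := hp_cover_spec CB hpc (CB.J (EA.compl q) a)
  have ha := hp_cover_spec CB hpc a
  set r := projCover EA CB (CB.J q a)
  set s := projCover EA CB (CB.J (EA.compl q) a)
  set t := projCover EA CB a
  have r1 : EA.le r q := (hr.2 q hq).1 (hp_Jle CB hq a)
  have s1 : EA.le s (EA.compl q) := (hs.2 _ (hp_Pcompl CB hq)).1 (hp_Jle CB (hp_Pcompl CB hq) a)
  have hat : EA.le a t := (ha.2 _ ha.1).2 (hp_le_refl EA _)
  have r2 : EA.le r t := (hr.2 _ ha.1).1 (hp_le_trans EA (hp_le_left EA h) hat)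
  have s2 : EA.le s t := (hs.2 _ ha.1).1 (hp_le_trans EA (hp_le_right EA h) hat)
  obtain ⟨z, hz⟩ := hp_le_orth EA (hp_le_trans EA s1 (hp_compl_anti EA r1))
  have hzP := hp_Padd CB hr.1 hs.1 hz
  have z1 : EA.le z t := hp_principal CB ha.1 r2 s2 hz
  have z2 : EA.le t z := by
    refine (ha.2 z hzP).1 (hp_principal CB hzP ?_ ?_ h)
    · exact hp_le_trans EA ((hr.2 _ hr.1).2 (hp_le_refl EA _)) (hp_le_left EA hz)
    · exact hp_le_trans EA ((hs.2 _ hs.1).2 (hp_le_refl EA _)) (hp_le_right EA hz)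
  have := hp_le_antisymm EA z1 z2
  subst this
  exact hp_inC_of_decomp CB hq r1 s1 hz

theorem hp_coverq_eq (hpc : ProjCoverProp EA CB) {q d : E} (hq : q ∈ CB.P) (hd : EA.le d q) :
    projCoverq EA CB q d = projCover EA CB d ∧ EA.le (projCover EA CB d) q := by
  have hs := hp_cover_spec CB hpc d
  have hle : EA.le (projCover EA CB d) q := (hs.2 q hq).1 hd
  have hex : ∃ p, IsProjCoverq EA CB q d p := ⟨_, ⟨hs.1, hle⟩, fun s hs2 => hs.2 s hs2.1⟩
  refine ⟨?_, hle⟩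
  unfold projCoverq
  rw [dif_pos hex]
  have h := hex.choose_spec
  apply hp_le_antisymm EA
  · exact (h.2 _ ⟨hs.1, hle⟩).1 (hp_cover_le CB hpc d)
  · exact (hs.2 _ h.1.1).1 ((h.2 _ h.1).2 (hp_le_refl EA _))

theorem hp_pmeet_eq {p q m : E} (h : IsMeetP EA CB p q m) : pmeet EA CB p q = m := by
  unfold pmeet
  have hex : ∃ m, IsMeetP EA CB p q m := ⟨m, h⟩
  rw [dif_pos hex]
  have h' := hex.choose_spec
  exact hp_le_antisymm EA (h.2.2.2 _ h'.1 h'.2.1 h'.2.2.1) (h'.2.2.2 _ h.1 h.2.1 h.2.2.1)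

theorem hp_pmeet_le {p q : E} (hp : p ∈ CB.P) (h : EA.le p q) : pmeet EA CB p q = p :=
  hp_pmeet_eq CB ⟨hp, hp_le_refl EA _, h, fun _ _ h1 _ => h1⟩

theorem hp_pmeet_compl {p q : E} (hp : p ∈ CB.P) (hq : q ∈ CB.P) (h : EA.le p q) :
    pmeet EA CB q (EA.compl p) = EA.osub q p := by
  have h0 := hp_osub_spec EA h
  refine hp_pmeet_eq CB ⟨(hp_osub_P CB hp hq h).2, hp_le_right EA h0, hp_orth_le EA h0, ?_⟩
  intro s _ h1 h2
  rw [(hp_osub_P CB hp hq h).1, ← hp_Jfix CB hq h1]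
  exact hp_Jmono CB hq h2

/-- nonemptiness of `P_≤` in `[0,q]` for complementary elements -/
theorem hp_Pleq_nonempty (hbc : BComparability EA CB) {q e f : E} (hq : q ∈ CB.P)
    (hef : EA.padd e f = some q) : (Pleq EA CB q e f).Nonempty := by
  have heq := hp_le_left EA hef
  have hfq := hp_le_right EA hef
  have hcomm : CommuteEl EA CB e f := by
    intro p hp r hr
    have hpq : inC EA CB p q := hp.2 q ⟨hq, hp_inC_of_le CB hq heq⟩
    have hfp : inC EA CB f p :=
      hp_inC_sub CB hp.1.1 hp.1.2 (hp_inC_symm CB hq hp.1.1 hpq) hef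
    exact hp_mackey_of_inC CB hp.1.1 (hr.2 p ⟨hp.1.1, hfp⟩)
  obtain ⟨p, ⟨hpP, hpA⟩, h1, h2⟩ := hbc.2 e f hcomm
  have hqPC : q ∈ PCset EA CB {e, f} := by
    refine ⟨hq, ?_⟩
    rintro x (rfl | rfl)
    · exact hp_inC_of_le CB hq heq
    · exact hp_inC_of_le CB hq hfq
  have hqp : inC EA CB q p := hpA q (Or.inl hqPC)
  obtain ⟨hmP, hJ⟩ := hp_JJ CB hpP hq hqp
  set m := CB.J p q with hm
  have hmq : EA.le m q := hp_le_left EA hqp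
  have hJm : ∀ x, EA.le x q → CB.J m x = CB.J p x := by
    intro x hx; rw [← hJ, hp_Jfix CB hq hx]
  have hmo : EA.osub q m = CB.J (EA.compl p) q := hp_osub_eq EA hqp
  have hJo : ∀ x, EA.le x q → CB.J (EA.osub q m) x = CB.J (EA.compl p) x := by
    intro x hx
    rw [hmo, ← (hp_JJ CB (hp_Pcompl CB hpP) hq (hp_inC_compl CB hqp)).2, hp_Jfix CB hq hx]
  have hin : ∀ x, EA.le x q → inC EA CB x p → inCq EA CB q x m := by
    intro x hx hxp
    unfold inCq
    rw [hJm x hx, hJo x hx]; exact hxp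
  refine ⟨m, ⟨⟨hmP, hmq⟩, ?_⟩, ?_, ?_⟩
  · rintro x (hx | hx)
    · refine hin x hx.1.2 (hpA x (Or.inl ⟨hx.1.1, ?_⟩))
      intro y hy
      have hyq : EA.le y q := by
        rcases hy with rfl | rfl
        · exact heq
        · exact hfq
      exact (hp_inCq_iff CB hx.1.1 hq hx.1.2 hyq).1 (hx.2 y hy)
    · have hxq : EA.le x q := by
        rcases hx with rfl | rfl
        · exact heq
        · exact hfq
      exact hin x hxq (hpA x (Or.inr hx))
  · rw [hJm _ heq, hJm _ hfq]; exact h1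
  · rw [hJo _ heq, hJo _ hfq]; exact h2

end Comp

section Block

variable {E : Type u} {EA : EffectAlgebra E} (CB : CompressionBase EA) {B : Set E}

theorem hp_B_P (hB : IsBlock EA CB B) {p : E} (hp : p ∈ B) : p ∈ CB.P := hB.1 hp

theorem hp_B_inC (hB : IsBlock EA CB B) {p q : E} (hp : p ∈ B) (hq : q ∈ B) : inC EA CB p q :=
  (hp_inC_of_mackey CB (hB.1 hq) (hB.2.1 q hq p hp)).1

theorem hp_B_C (hB : IsBlock EA CB B) {p : E} (hp : p ∈ B) : p ∈ Cblock EA CB B :=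
  fun _ hq => hp_B_inC CB hB hp hq

theorem hp_B_of_C (hB : IsBlock EA CB B) {p : E} (hp : p ∈ CB.P) (h : p ∈ Cblock EA CB B) :
    p ∈ B := by
  have hm : ∀ q ∈ B, EA.Mackey q p := fun q hq => hp_mackey_of_inC CB (hB.1 hq) (h q hq)
  have := hB.2.2 (insert p B) (Set.insert_subset hp hB.1) ?_ (Set.subset_insert p B)
  · rw [← this]; exact Set.mem_insert p B
  · rintro x (rfl | hx) y (rfl | hy)
    · exact hp_mackey_refl EA _
    · exact hp_mackey_symm EA (hm y hy)
    · exact hm x hx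
    · exact hB.2.1 x hx y hy

theorem hp_C_add (hB : IsBlock EA CB B) {x y z : E} (hx : x ∈ Cblock EA CB B)
    (hy : y ∈ Cblock EA CB B) (h : EA.padd x y = some z) : z ∈ Cblock EA CB B :=
  fun p hp => hp_inC_add CB (hB.1 hp) (hx p hp) (hy p hp) h

theorem hp_C_sub (hB : IsBlock EA CB B) {x y z : E} (hx : x ∈ Cblock EA CB B)
    (hz : z ∈ Cblock EA CB B) (h : EA.padd x y = some z) : y ∈ Cblock EA CB B :=
  fun p hp => hp_inC_sub CB (hB.1 hp) (hx p hp) (hz p hp) h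

theorem hp_C_one (hB : IsBlock EA CB B) : EA.one ∈ Cblock EA CB B := by
  intro p hp
  unfold inC
  rw [CB.focus p (hB.1 hp), CB.focus _ (hp_Pcompl CB (hB.1 hp)), hp_compl_spec]

theorem hp_C_zero (hB : IsBlock EA CB B) : EA.zero ∈ Cblock EA CB B :=
  fun _ hp => hp_inC_of_le CB (hB.1 hp) (hp_zero_le EA _)

theorem hp_C_J (hB : IsBlock EA CB B) {p x : E} (hp : p ∈ B) (hx : x ∈ Cblock EA CB B) :
    CB.J p x ∈ Cblock EA CB B :=
  fun q hq => hp_inC_J CB (hB.1 hp) (hB.1 hq) (hp_B_inC CB hB hq hp) (hx q hq)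

theorem hp_B_one (hB : IsBlock EA CB B) : EA.one ∈ B :=
  hp_B_of_C CB hB (hp_P1 CB) (hp_C_one CB hB)
theorem hp_B_zero (hB : IsBlock EA CB B) : EA.zero ∈ B :=
  hp_B_of_C CB hB (hp_P0 CB) (hp_C_zero CB hB)
theorem hp_B_compl (hB : IsBlock EA CB B) {p : E} (hp : p ∈ B) : EA.compl p ∈ B :=
  hp_B_of_C CB hB (hp_Pcompl CB (hB.1 hp))
    (hp_C_sub CB hB (hp_B_C CB hB hp) (hp_C_one CB hB) (hp_compl_spec EA p))
theorem hp_B_add (hB : IsBlock EA CB B) {p q r : E} (hp : p ∈ B) (hq : q ∈ B)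
    (h : EA.padd p q = some r) : r ∈ B :=
  hp_B_of_C CB hB (hp_Padd CB (hB.1 hp) (hB.1 hq) h)
    (hp_C_add CB hB (hp_B_C CB hB hp) (hp_B_C CB hB hq) h)
theorem hp_B_J (hB : IsBlock EA CB B) {p q : E} (hp : p ∈ B) (hq : q ∈ B) : CB.J p q ∈ B :=
  hp_B_of_C CB hB (hp_JJ CB (hB.1 hp) (hB.1 hq) (hp_B_inC CB hB hq hp)).1
    (hp_C_J CB hB hp (hp_B_C CB hB hq))
theorem hp_B_osub (hB : IsBlock EA CB B) {p q : E} (hp : p ∈ B) (hq : q ∈ B) (h : EA.le p q) :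
    EA.osub q p ∈ B :=
  hp_B_of_C CB hB (hp_osub_P CB (hB.1 hp) (hB.1 hq) h).2
    (hp_C_sub CB hB (hp_B_C CB hB hp) (hp_B_C CB hB hq) (hp_osub_spec EA h))
theorem hp_B_cover (hB : IsBlock EA CB B) (hpc : ProjCoverProp EA CB) {x : E}
    (hx : x ∈ Cblock EA CB B) : projCover EA CB x ∈ B :=
  hp_B_of_C CB hB (hp_cover_spec CB hpc x).1
    fun p hp => hp_cover_inC CB hpc (hB.1 hp) (hx p hp)

theorem hp_B_Pleq (hB : IsBlock EA CB B) {q e f p : E} (hq : q ∈ B) (he : e ∈ Cblock EA CB B)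
    (hf : f ∈ Cblock EA CB B) (heq : EA.le e q) (hfq : EA.le f q) (hp : p ∈ Pleq EA CB q e f) :
    p ∈ B := by
  obtain ⟨⟨⟨hpP, hpq⟩, hpA⟩, -, -⟩ := hp
  refine hp_B_of_C CB hB hpP fun b hb => ?_
  have hqP := hB.1 hq
  have hbq := hp_B_J CB hB hq hb
  have hle := hp_Jle CB hqP b
  have hmem : CB.J q b ∈ PCsetq EA CB q {e, f} := by
    refine ⟨⟨hB.1 hbq, hle⟩, ?_⟩
    rintro y (rfl | rfl)
    · exact (hp_inCq_iff CB (hB.1 hbq) hqP hle heq).2 (he _ hbq)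
    · exact (hp_inCq_iff CB (hB.1 hbq) hqP hle hfq).2 (hf _ hbq)
  have h1 : inC EA CB (CB.J q b) p :=
    (hp_inCq_iff CB hpP hqP hpq hle).1 (hpA _ (Or.inl hmem))
  have h2 : inC EA CB (CB.J (EA.compl q) b) p := by
    rw [← hp_compl_compl EA p]
    refine hp_inC_compl CB (hp_inC_of_le CB (hp_Pcompl CB hpP) ?_)
    exact hp_le_trans EA (hp_Jle CB (hp_Pcompl CB hqP) b) (hp_compl_anti EA hpq)
  exact hp_inC_symm CB hpP (hB.1 hb) (hp_inC_add CB hpP h1 h2 (hp_B_inC CB hB hb hq))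

end Block

section Grp

set_option linter.unusedSectionVars false

variable {E : Type u} {EA : EffectAlgebra E} {CB : CompressionBase EA} {B : Set E}
  {G : Type u} [AddCommGroup G] [Lattice G] [IsOrderedAddMonoid G]

/-- the data of the universal group of a C-block, packaged -/
structure HpG (CB : CompressionBase EA) (B : Set E) (u : G) (φ : E → G) (Ut : E → G → G) :
    Prop where
  hB : IsBlock EA CB B
  one : φ EA.one = u
  mem : ∀ x ∈ Cblock EA CB B, 0 ≤ φ x ∧ φ x ≤ u
  inj : ∀ x ∈ Cblock EA CB B, ∀ y ∈ Cblock EA CB B, φ x = φ y → x = y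
  surj : ∀ g : G, 0 ≤ g → g ≤ u → ∃ x ∈ Cblock EA CB B, φ x = g
  add : ∀ x ∈ Cblock EA CB B, ∀ y ∈ Cblock EA CB B, ∀ z : E,
      EA.padd x y = some z → φ z = φ x + φ y
  add' : ∀ x ∈ Cblock EA CB B, ∀ y ∈ Cblock EA CB B, φ x + φ y ≤ u →
      ∃ z : E, EA.padd x y = some z
  uniq : ∀ f g : G → G, (∀ x y, f (x + y) = f x + f y) → (∀ x y, g (x + y) = g x + g y) →
      (∀ x ∈ Cblock EA CB B, f (φ x) = g (φ x)) → f = g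
  Uadd : ∀ p ∈ B, ∀ g g' : G, Ut p (g + g') = Ut p g + Ut p g'
  Umono : ∀ p ∈ B, ∀ g g' : G, g ≤ g' → Ut p g ≤ Ut p g'
  UJ : ∀ p ∈ B, ∀ x ∈ Cblock EA CB B, Ut p (φ x) = φ (CB.J p x)

namespace HpG

variable {u : G} {φ : E → G} {Ut : E → G → G}

theorem zero (S : HpG CB B u φ Ut) : φ EA.zero = 0 := by
  have h0 := hp_C_zero CB S.hB
  have := S.add _ h0 _ h0 _ (hp_zero_add EA _)
  simpa using this

theorem le_iff (S : HpG CB B u φ Ut) {x y : E} (hx : x ∈ Cblock EA CB B) (hy : y ∈ Cblock EA CB B) :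
    EA.le x y ↔ φ x ≤ φ y := by
  constructor
  · rintro ⟨z, hz⟩
    have hzC := hp_C_sub CB S.hB hx hy hz
    rw [S.add x hx z hzC y hz]
    exact le_add_of_nonneg_right (S.mem z hzC).1
  · intro h
    obtain ⟨z, hz, hz'⟩ := S.surj (φ y - φ x) (sub_nonneg.2 h)
      ((sub_le_self _ (S.mem x hx).1).trans (S.mem y hy).2)
    have hs : φ x + φ z = φ y := by rw [hz']; abel
    obtain ⟨t, ht⟩ := S.add' x hx z hz (by rw [hs]; exact (S.mem y hy).2)
    have h1 := S.add x hx z hz t ht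
    have := S.inj t (hp_C_add CB S.hB hx hz ht) y hy (by rw [h1, hs])
    subst this
    exact ⟨_, ht⟩

theorem U0 (S : HpG CB B u φ Ut) {p : E} (hp : p ∈ B) : Ut p 0 = 0 := (AddMonoidHom.mk' (Ut p) (S.Uadd p hp)).map_zero
theorem Usub (S : HpG CB B u φ Ut) {p : E} (hp : p ∈ B) (g h : G) : Ut p (g - h) = Ut p g - Ut p h :=
  (AddMonoidHom.mk' (Ut p) (S.Uadd p hp)).map_sub g h
theorem Unsmul (S : HpG CB B u φ Ut) {p : E} (hp : p ∈ B) (n : ℕ) (g : G) : Ut p (n • g) = n • Ut p g :=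
  (AddMonoidHom.mk' (Ut p) (S.Uadd p hp)).map_nsmul n g
theorem Usum (S : HpG CB B u φ Ut) {p : E} (hp : p ∈ B) (l : List G) : Ut p l.sum = (l.map (Ut p)).sum :=
  map_list_sum (AddMonoidHom.mk' (Ut p) (S.Uadd p hp)) l

theorem Uu (S : HpG CB B u φ Ut) {p : E} (hp : p ∈ B) : Ut p u = φ p := by
  rw [← S.one, S.UJ p hp _ (hp_C_one CB S.hB), CB.focus p (S.hB.1 hp)]

theorem Unonneg (S : HpG CB B u φ Ut) {p : E} (hp : p ∈ B) {g : G} (h : 0 ≤ g) : 0 ≤ Ut p g := by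
  have := S.Umono p hp 0 g h
  rwa [S.U0 hp] at this

theorem Unonpos (S : HpG CB B u φ Ut) {p : E} (hp : p ∈ B) {g : G} (h : g ≤ 0) : Ut p g ≤ 0 := by
  have := S.Umono p hp g 0 h
  rwa [S.U0 hp] at this

theorem Ucompl (S : HpG CB B u φ Ut) {p : E} (hp : p ∈ B) (g : G) : Ut p g + Ut (EA.compl p) g = g := by
  have hp' := hp_B_compl CB S.hB hp
  have := S.uniq (fun g => Ut p g + Ut (EA.compl p) g) id
    (fun x y => by simp only [S.Uadd p hp, S.Uadd _ hp']; abel) (fun _ _ => rfl) ?_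
  · exact congrFun this g
  · intro x hx
    simp only [S.UJ p hp x hx, S.UJ _ hp' x hx, id]
    exact (S.add _ (hp_C_J CB S.hB hp hx) _ (hp_C_J CB S.hB hp' hx) _ (hx p hp)).symm

theorem Ule (S : HpG CB B u φ Ut) {p : E} (hp : p ∈ B) {g : G} (h : 0 ≤ g) : Ut p g ≤ g := by
  conv_rhs => rw [← S.Ucompl hp g]
  exact le_add_of_nonneg_right (S.Unonneg (hp_B_compl CB S.hB hp) h)

theorem Ucomp (S : HpG CB B u φ Ut) {p q : E} (hp : p ∈ B) (hq : q ∈ B) (g : G) :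
    Ut p (Ut q g) = Ut (CB.J p q) g := by
  have hr := hp_B_J CB S.hB hp hq
  have := S.uniq (fun g => Ut p (Ut q g)) (fun g => Ut (CB.J p q) g)
    (fun x y => by simp only [S.Uadd p hp, S.Uadd _ hq]) (S.Uadd _ hr) ?_
  · exact congrFun this g
  · intro x hx
    simp only [S.UJ q hq x hx, S.UJ p hp _ (hp_C_J CB S.hB hq hx), S.UJ _ hr x hx]
    rw [(hp_JJ CB (S.hB.1 hp) (S.hB.1 hq) (hp_B_inC CB S.hB hq hp)).2]

theorem Ucomp_le (S : HpG CB B u φ Ut) {p q : E} (hp : p ∈ B) (hq : q ∈ B) (h : EA.le p q) (g : G) :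
    Ut p (Ut q g) = Ut p g := by
  rw [S.Ucomp hp hq, hp_meet_comm CB (S.hB.1 hp) (S.hB.1 hq) (hp_B_inC CB S.hB hq hp),
    hp_Jfix CB (S.hB.1 hq) h]

theorem Uself (S : HpG CB B u φ Ut) {p : E} (hp : p ∈ B) (g : G) : Ut p (Ut p g) = Ut p g :=
  S.Ucomp_le hp hp (hp_le_refl EA p) g

theorem Uadd_proj (S : HpG CB B u φ Ut) {p q r : E} (hp : p ∈ B) (hq : q ∈ B) (h : EA.padd p q = some r) (g : G) :
    Ut r g = Ut p g + Ut q g := by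
  have hr := hp_B_add CB S.hB hp hq h
  have hp' := hp_B_compl CB S.hB hp
  have hpr := hp_le_left EA h
  have h1 := S.Ucompl hp (Ut r g)
  rw [S.Ucomp_le hp hr hpr, S.Ucomp hp' hr,
    hp_meet_comm CB (S.hB.1 hp') (S.hB.1 hr) (hp_B_inC CB S.hB hr hp'),
    ← (hp_osub_P CB (S.hB.1 hp) (S.hB.1 hr) hpr).1, hp_osub_eq EA h] at h1
  exact h1.symm

/-- the Rickart condition for positive parts -/
theorem pos_iff (S : HpG CB B u φ Ut) {p : E} (hp : p ∈ B) (g : G) :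
    (g ⊔ 0 = Ut p (g ⊔ 0) + Ut (EA.compl p) (g ⊔ 0) ∧ Ut p (g ⊔ 0) = 0) ↔ Ut p g ≤ 0 := by
  have hp' := hp_B_compl CB S.hB hp
  constructor
  · rintro ⟨-, h⟩
    rw [← h]; exact S.Umono p hp _ _ le_sup_left
  · intro h
    refine ⟨(S.Ucompl hp _).symm, le_antisymm ?_ (S.Unonneg hp le_sup_right)⟩
    have h1 : g ⊔ 0 ≤ Ut (EA.compl p) (g ⊔ 0) := by
      refine sup_le ?_ (S.Unonneg hp' le_sup_right)
      calc g = Ut p g + Ut (EA.compl p) g := (S.Ucompl hp g).symm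
        _ ≤ 0 + Ut (EA.compl p) (g ⊔ 0) := add_le_add h (S.Umono _ hp' _ _ le_sup_left)
        _ = _ := zero_add _
    have h2 := S.Umono p hp _ _ h1
    have h3 := S.Ucompl hp (Ut p (g ⊔ 0))
    have h4 : Ut p (Ut (EA.compl p) (g ⊔ 0)) = 0 := by
      have := S.Uadd p hp (Ut p (g ⊔ 0)) (Ut (EA.compl p) (g ⊔ 0))
      rw [S.Ucompl hp, S.Uself hp] at this
      simpa using this
    rwa [h4] at h2

theorem listSum_aux (S : HpG CB B u φ Ut) (l : List E) : ∀ acc : E, acc ∈ B → (∀ x ∈ l, x ∈ B) →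
    φ acc + (l.map φ).sum ≤ u →
    l.foldl (fun acc x => EA.oplusD acc x) acc ∈ B ∧
    φ (l.foldl (fun acc x => EA.oplusD acc x) acc) = φ acc + (l.map φ).sum ∧
    ∀ g, Ut (l.foldl (fun acc x => EA.oplusD acc x) acc) g
      = Ut acc g + (l.map fun x => Ut x g).sum := by
  induction l with
  | nil => intro acc h _ _; simp [h]
  | cons x l ih =>
    intro acc hacc hl hsum
    have hx : x ∈ B := hl x (by simp)
    have hl' : ∀ y ∈ l, y ∈ B := fun y hy => hl y (by simp [hy])
    have hnn : 0 ≤ (l.map φ).sum := by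
      apply List.sum_nonneg
      intro g hg
      obtain ⟨y, hy, rfl⟩ := List.mem_map.1 hg
      exact (S.mem y (hp_B_C CB S.hB (hl' y hy))).1
    simp only [List.map_cons, List.sum_cons] at hsum ⊢
    rw [← add_assoc] at hsum
    have haC := hp_B_C CB S.hB hacc
    have hxC := hp_B_C CB S.hB hx
    obtain ⟨z, hz⟩ := S.add' acc haC x hxC ((le_add_of_nonneg_right hnn).trans hsum)
    have hod : EA.oplusD acc x = z := by simp [oplusD, hz]
    have hzB := hp_B_add CB S.hB hacc hx hz
    have hφz := S.add _ haC _ hxC _ hz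
    obtain ⟨h1, h2, h3⟩ := ih z hzB hl' (by rw [hφz]; exact hsum)
    simp only [List.foldl_cons, hod]
    refine ⟨h1, ?_, ?_⟩
    · rw [h2, hφz]; abel
    · intro g
      rw [h3 g, S.Uadd_proj hacc hx hz]; abel

theorem listSum_spec (S : HpG CB B u φ Ut) (l : List E) (hl : ∀ x ∈ l, x ∈ B) (hs : (l.map φ).sum ≤ u) :
    listSum EA l ∈ B ∧ φ (listSum EA l) = (l.map φ).sum ∧
    ∀ g, Ut (listSum EA l) g = (l.map fun x => Ut x g).sum := by
  have h0 := hp_B_zero CB S.hB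
  obtain ⟨h1, h2, h3⟩ := S.listSum_aux l EA.zero h0 hl (by rw [S.zero, zero_add]; exact hs)
  refine ⟨h1, ?_, ?_⟩
  · unfold listSum; rw [h2, S.zero, zero_add]
  · intro g
    unfold listSum
    rw [h3 g]
    have : Ut EA.zero g = 0 := by
      have := S.Uadd_proj h0 h0 (hp_zero_add EA EA.zero) g
      simpa using this
    rw [this, zero_add]

end HpG

/-- the invariant of the binary construction -/
def HpInv (CB : CompressionBase EA) (B : Set E) (φ : E → G) (Ut : E → G → G) (a : E)
    (k N : ℕ) (q c : E) : Prop :=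
  q ∈ B ∧ c ∈ Cblock EA CB B ∧ EA.le c q ∧ φ c + N • φ q = (2 ^ k) • Ut q (φ a) ∧
    ∀ p ∈ B, EA.le p q → Ut p (φ c) = 0 → p = EA.zero

theorem HpG.step {u : G} {φ : E → G} {Ut : E → G → G} (S : HpG CB B u φ Ut)
    (hspec : Spectral EA CB) {a : E} {k N : ℕ} {q c : E}
    (h : HpInv CB B φ Ut a k N q c) (d u0 : E)
    (hd : d = posPartq EA CB q (EA.osub q c) c)
    (hu0 : u0 = pmeet EA CB (EA.osub q (projCoverq EA CB q d)) q) :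
    HpInv CB B φ Ut a (k + 1) (2 * N) u0 (EA.oplusD (CB.J u0 c) (CB.J u0 c)) ∧
    HpInv CB B φ Ut a (k + 1) (2 * N + 1) (pmeet EA CB q (EA.compl u0)) d ∧
    EA.padd u0 (pmeet EA CB q (EA.compl u0)) = some q := by
  obtain ⟨hq, hc, hcq, hform, hstrict⟩ := h
  have hB := S.hB
  have hqP := hB.1 hq
  have hqC := hp_B_C CB hB hq
  have hsum := hp_osub_spec EA hcq
  set e := EA.osub q c with he
  have heC : e ∈ Cblock EA CB B := hp_C_sub CB hB hc hqC hsum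
  have heq : EA.le e q := hp_le_right EA hsum
  have hφq := S.add _ hc _ heC _ hsum
  have hne : (Pleq EA CB q e c).Nonempty :=
    hp_Pleq_nonempty CB hspec.2 hqP (by rw [EA.comm]; exact hsum)
  unfold posPartq at hd
  rw [dif_pos hne] at hd
  have hp := hne.some_mem
  set p := hne.some
  have hpB : p ∈ B := hp_B_Pleq CB hB hq heC hc heq hcq hp
  obtain ⟨⟨⟨hpP, hpq⟩, -⟩, hp1, hp2⟩ := hp
  have hJc := hp_C_J CB hB hpB hc
  have hJe := hp_C_J CB hB hpB heC
  have hdsum := hp_osub_spec EA hp1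
  rw [← hd] at hdsum
  have hdC : d ∈ Cblock EA CB B := hp_C_sub CB hB hJe hJc hdsum
  have hdp : EA.le d p := hp_le_trans EA (hp_le_right EA hdsum) (hp_Jle CB hpP c)
  have hdq := hp_le_trans EA hdp hpq
  have hφd : φ d = Ut p (φ c - φ e) := by
    have := S.add _ hJe _ hdC _ hdsum
    rw [S.Usub hpB, S.UJ p hpB c hc, S.UJ p hpB e heC, this]; abel
  obtain ⟨hcov, hcovq⟩ := hp_coverq_eq CB hspec.1 hqP hdq
  have hsB : projCover EA CB d ∈ B := hp_B_cover CB hB hspec.1 hdC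
  have hscov := hp_cover_spec CB hspec.1 d
  have hds := hp_cover_le CB hspec.1 d
  rw [hcov] at hu0
  set s := projCover EA CB d with hs
  have hsP := hB.1 hsB
  have hoB := hp_B_osub CB hB hsB hq hcovq
  have hosum := hp_osub_spec EA hcovq
  rw [hp_pmeet_le CB (hB.1 hoB) (hp_le_right EA hosum)] at hu0
  rw [← hu0] at hoB hosum
  have hu0q : EA.le u0 q := hp_le_right EA hosum
  have hosum' : EA.padd u0 s = some q := by rw [EA.comm]; exact hosum
  have hu1 : pmeet EA CB q (EA.compl u0) = s := by
    rw [hp_pmeet_compl CB (hB.1 hoB) hqP hu0q, hp_osub_eq EA hosum']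
  rw [hu1]
  have hu0P := hB.1 hoB
  -- restriction to u0
  have hneg : Ut u0 (φ c - φ e) ≤ 0 := by
    have hpo := hp_B_osub CB hB hpB hq hpq
    have h1 : Ut q (φ c - φ e) = Ut p (φ c - φ e) + Ut (EA.osub q p) (φ c - φ e) :=
      S.Uadd_proj hpB hpo (hp_osub_spec EA hpq) _
    have h2 : Ut (EA.osub q p) (φ c - φ e) ≤ 0 := by
      rw [S.Usub hpo, S.UJ _ hpo c hc, S.UJ _ hpo e heC, sub_nonpos]
      exact (S.le_iff (hp_C_J CB hB hpo hc) (hp_C_J CB hB hpo heC)).1 hp2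
    have h3 : Ut u0 (φ d) = 0 := by
      rw [S.UJ u0 hoB d hdC, (hp_Jzero_iff CB hu0P).2, S.zero]
      exact hp_le_trans EA hds (hp_orth_le EA hosum')
    rw [← S.Ucomp_le hoB hq hu0q, h1, S.Uadd _ hoB, ← hφd, h3, zero_add]
    exact S.Unonpos hoB h2
  have hJuc := hp_C_J CB hB hoB hc
  have hu0C := hp_B_C CB hB hoB
  have hφJ : φ (CB.J u0 c) = Ut u0 (φ c) := (S.UJ u0 hoB c hc).symm
  have hUq : ∀ r ∈ B, EA.le r q → Ut r (φ q) = φ r := by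
    intro r hr hrq
    rw [← S.Uu hq, S.Ucomp_le hr hq hrq, S.Uu hr]
  have h2le : φ (CB.J u0 c) + φ (CB.J u0 c) ≤ φ u0 := by
    rw [← hUq u0 hoB hu0q, hφq, S.Uadd _ hoB, hφJ]
    have := hneg
    rw [S.Usub hoB, sub_nonpos] at this
    exact add_le_add le_rfl this
  obtain ⟨z, hz⟩ := S.add' _ hJuc _ hJuc (h2le.trans (S.mem _ hu0C).2)
  have hod : EA.oplusD (CB.J u0 c) (CB.J u0 c) = z := by simp [oplusD, hz]
  rw [hod]
  have hzC := hp_C_add CB hB hJuc hJuc hz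
  have hφz := S.add _ hJuc _ hJuc _ hz
  have hformr : ∀ r ∈ B, EA.le r q → Ut r (φ c) + N • φ r = (2 ^ k) • Ut r (φ a) := by
    intro r hr hrq
    have := congrArg (Ut r) hform
    rw [S.Uadd _ hr, S.Unsmul hr, S.Unsmul hr, hUq r hr hrq, S.Ucomp_le hr hq hrq] at this
    exact this
  refine ⟨⟨hoB, hzC, ?_, ?_, ?_⟩, ⟨hsB, hdC, hds, ?_, ?_⟩, hosum'⟩
  · rw [S.le_iff hzC hu0C, hφz]; exact h2le
  · have := hformr u0 hoB hu0q
    rw [pow_succ, mul_comm (2 ^ k) 2, mul_smul 2 (2 ^ k), ← this, hφz, hφJ, mul_smul 2 N,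
      smul_add, two_nsmul (Ut u0 (φ c))]
  · intro r hr hru hrz
    refine hstrict r hr (hp_le_trans EA hru hu0q) ?_
    rw [hφz, S.Uadd _ hr, hφJ, S.Ucomp_le hr hoB hru] at hrz
    have h0 : 0 ≤ Ut r (φ c) := S.Unonneg hr (S.mem c hc).1
    exact le_antisymm ((le_add_of_nonneg_right h0).trans hrz.le) h0
  · have h1 := hformr s hsB hcovq
    have hps : EA.le s p := (hscov.2 p hpP).1 hdp
    have h2 : φ d = Ut s (φ c) - Ut s (φ e) := by
      have : Ut s (φ d) = φ d := by rw [S.UJ s hsB d hdC, hp_Jfix CB hsP hds]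
      rw [← this, hφd, S.Ucomp_le hsB hpB hps, S.Usub hsB]
    have h3 : φ s = Ut s (φ c) + Ut s (φ e) := by
      rw [← S.Uadd _ hsB, ← hφq, hUq s hsB hcovq]
    rw [pow_succ, mul_comm (2 ^ k) 2, mul_smul 2 (2 ^ k), ← h1, h2, add_smul, mul_smul 2 N, one_smul,
      smul_add, two_nsmul (Ut s (φ c))]
    nth_rewrite 2 [h3]
    abel
  · intro r hr hrs hr0
    rw [S.UJ r hr d hdC, ← S.zero] at hr0
    have := S.inj _ (hp_C_J CB hB hr hdC) _ (hp_C_zero CB hB) hr0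
    rw [hp_Jzero_iff CB (hB.1 hr)] at this
    have h1 := (hscov.2 _ (hp_Pcompl CB (hB.1 hr))).1 this
    exact hp_self_orth CB (hB.1 hr) (hp_le_trans EA hrs h1)

/-- value of a reversed binary string -/
def hpN : List Bool → ℕ
  | [] => 0
  | b :: t => 2 * hpN t + (if b then 1 else 0)

theorem hp_lam_append (w : List Bool) (b : Bool) :
    lamOf (w ++ [b]) = lamOf w + (if b then 1 else 0) / 2 ^ (w.length + 1) := by
  induction w with
  | nil => simp [lamOf]
  | cons x w ih =>
    simp only [List.cons_append, lamOf, ih, List.length_cons]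
    rw [pow_succ _ (w.length + 1)]
    field_simp
    ring

theorem hp_lam_N (v : List Bool) : lamOf v.reverse = (hpN v : ℚ) / 2 ^ v.length := by
  induction v with
  | nil => simp [lamOf, hpN]
  | cons b t ih =>
    rw [List.reverse_cons, hp_lam_append, ih, List.length_reverse, List.length_cons]
    simp only [hpN]
    rw [pow_succ]
    push_cast
    field_simp

theorem hp_lam_N' (w : List Bool) : lamOf w = (hpN w.reverse : ℚ) / 2 ^ w.length := by
  have := hp_lam_N w.reverse
  rwa [List.reverse_reverse, List.length_reverse] at this

theorem hp_inv {u : G} {φ : E → G} {Ut : E → G → G} (S : HpG CB B u φ Ut)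
    (hspec : Spectral EA CB) {a : E} (ha : a ∈ Cblock EA CB B) (v : List Bool) :
    HpInv CB B φ Ut a v.length (hpN v) (ucAux EA CB a v).1 (ucAux EA CB a v).2 := by
  induction v with
  | nil =>
    have hB := S.hB
    have hsB := hp_B_cover CB hB hspec.1 ha
    have hle := hp_cover_le CB hspec.1 a
    refine ⟨hsB, ha, hle, ?_, ?_⟩
    · simp only [ucAux, hpN, List.length_nil, zero_smul, pow_zero, one_smul, add_zero]
      rw [S.UJ _ hsB a ha, hp_Jfix CB (hB.1 hsB) hle]
    · intro r hr hrs hr0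
      simp only [ucAux] at hr0 hrs
      rw [S.UJ r hr a ha, ← S.zero] at hr0
      have := S.inj _ (hp_C_J CB hB hr ha) _ (hp_C_zero CB hB) hr0
      rw [hp_Jzero_iff CB (hB.1 hr)] at this
      have h1 := ((hp_cover_spec CB hspec.1 a).2 _ (hp_Pcompl CB (hB.1 hr))).1 this
      exact hp_self_orth CB (hB.1 hr) (hp_le_trans EA hrs h1)
  | cons b t ih =>
    obtain ⟨h0, h1, -⟩ := S.step hspec ih _ _ rfl rfl
    cases b
    · simpa [ucAux, hpN] using h0
    · simpa [ucAux, hpN] using h1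

theorem hp_split {u : G} {φ : E → G} {Ut : E → G → G} (S : HpG CB B u φ Ut)
    (hspec : Spectral EA CB) {a : E} (ha : a ∈ Cblock EA CB B) (w : List Bool) :
    φ (uw EA CB a (w ++ [false])) + φ (uw EA CB a (w ++ [true])) = φ (uw EA CB a w) := by
  have ih := hp_inv S hspec ha w.reverse
  obtain ⟨h0, h1, h2⟩ := S.step hspec ih _ _ rfl rfl
  have h3 := S.add _ (hp_B_C CB S.hB h0.1) _ (hp_B_C CB S.hB h1.1) _ h2
  simp only [uw, List.reverse_append, List.reverse_cons, List.reverse_nil, List.nil_append,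
    List.singleton_append, ucAux]
  simpa using h3.symm

theorem hp_sum_flat {M : Type*} [AddCommMonoid M] (f : List Bool → M) (l : List (List Bool)) :
    ((l.flatMap fun w => [w ++ [false], w ++ [true]]).map f).sum
      = (l.map fun w => f (w ++ [false]) + f (w ++ [true])).sum := by
  induction l with
  | nil => simp
  | cons x l ih =>
    simp only [List.flatMap_cons, List.map_append, List.sum_append, ih, List.map_cons,
      List.sum_cons, List.map_nil, List.sum_nil, add_zero]

theorem hp_len (n : ℕ) : ∀ v ∈ allStrings n, v.length = n := by
  induction n with
  | zero => simp [allStrings]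
  | succ n ih =>
    intro v hv
    simp only [allStrings, List.mem_flatMap] at hv
    obtain ⟨w, hw, hv⟩ := hv
    have := ih w hw
    simp at hv
    rcases hv with rfl | rfl <;> simp [this]

theorem hp_total {u : G} {φ : E → G} {Ut : E → G → G} (S : HpG CB B u φ Ut)
    (hspec : Spectral EA CB) {a : E} (ha : a ∈ Cblock EA CB B) (n : ℕ) :
    ((allStrings n).map fun v => φ (uw EA CB a v)).sum = φ (projCover EA CB a) := by
  induction n with
  | zero => simp [allStrings, uw, ucAux]
  | succ n ih =>
    simp only [allStrings]
    rw [hp_sum_flat, ← ih]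
    simp only [hp_split S hspec ha]

theorem hp_sum_filter {M : Type*} [AddCommMonoid M] {α : Type*} (l : List α) (P : α → Bool)
    (f : α → M) : (l.map f).sum = ((l.filter P).map f).sum +
      ((l.filter fun x => !P x).map f).sum := by
  induction l with
  | nil => simp
  | cons x l ih =>
    by_cases h : P x <;> simp [h, ih] <;> abel

theorem hp_sum_nonpos (l : List G) (h : ∀ x ∈ l, x ≤ 0) : l.sum ≤ 0 := by
  induction l with
  | nil => simp
  | cons x l ih =>
    rw [List.sum_cons]
    exact add_nonpos (h x (by simp)) (ih fun y hy => h y (by simp [hy]))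

theorem hp_pbin {u : G} {φ : E → G} {Ut : E → G → G} (S : HpG CB B u φ Ut)
    (hspec : Spectral EA CB) {a : E} (ha : a ∈ Cblock EA CB B) (w : List Bool) (M : ℕ)
    (hM : lamOf (w ++ [true]) = (M : ℚ) / 2 ^ (w.length + 1)) :
    pbin EA CB a w ∈ B ∧ ∀ p ∈ B, (EA.le p (pbin EA CB a w) ↔
      Ut p ((2 ^ (w.length + 1)) • φ a - M • u) ≤ 0) := by
  have hB := S.hB
  set K := w.length + 1 with hK
  have hM' : ∀ v ∈ allStrings K, (lamOf v ≤ lamOf (w ++ [false]) ↔ hpN v.reverse + 1 ≤ M) := by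
    intro v hv
    have hl := hp_len K v hv
    have h1 : lamOf (w ++ [false]) = ((M : ℚ) - 1) / 2 ^ K := by
      rw [hp_lam_append] at hM ⊢
      have : lamOf w = (M : ℚ) / 2 ^ K - 1 / 2 ^ K := by
        rw [← hM]; simp [hK]
      rw [this]; simp; ring
    rw [h1, hp_lam_N', hl, div_le_div_iff_of_pos_right (by positivity), le_sub_iff_add_le]
    exact_mod_cast Iff.rfl
  set F := (allStrings K).filter fun v => lamOf v ≤ lamOf (w ++ [false]) with hF
  set F' := (allStrings K).filter fun v => !decide (lamOf v ≤ lamOf (w ++ [false])) with hF'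
  have huB : ∀ v, uw EA CB a v ∈ B := fun v => (hp_inv S hspec ha v.reverse).1
  have huC : ∀ v, uw EA CB a v ∈ Cblock EA CB B := fun v => hp_B_C CB hB (huB v)
  have hsB := hp_B_cover CB hB hspec.1 ha
  have hscB := hp_B_compl CB hB hsB
  set s := projCover EA CB a with hs
  have hs1 : φ s + φ (EA.compl s) = u := by
    rw [← S.one, S.add _ (hp_B_C CB hB hsB) _ (hp_B_C CB hB hscB) _ (hp_compl_spec EA s)]
  have htot : (F.map fun v => φ (uw EA CB a v)).sum + (F'.map fun v => φ (uw EA CB a v)).sum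
      = φ s := by
    rw [← hp_total S hspec ha K]
    exact (hp_sum_filter _ _ _).symm
  have hFcnn : 0 ≤ (F'.map fun v => φ (uw EA CB a v)).sum := by
    apply List.sum_nonneg
    intro g hg
    obtain ⟨y, hy, rfl⟩ := List.mem_map.1 hg
    exact (S.mem _ (huC y)).1
  obtain ⟨hDB, hDφ, hDU⟩ := S.listSum_spec (EA.compl s :: F.map (uw EA CB a))
    (by
      intro x hx
      rcases List.mem_cons.1 hx with rfl | hx
      · exact hscB
      · obtain ⟨y, hy, rfl⟩ := List.mem_map.1 hx
        exact huB y)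
    (by
      rw [List.map_cons, List.sum_cons, List.map_map, ← hs1, add_comm, ← htot]
      exact add_le_add (le_add_of_nonneg_right hFcnn) le_rfl)
  have hD : pbin EA CB a w = listSum EA (EA.compl s :: F.map (uw EA CB a)) := rfl
  rw [← hD] at hDB hDφ hDU
  set D := pbin EA CB a w
  simp only [List.map_cons, List.sum_cons, List.map_map] at hDφ hDU
  refine ⟨hDB, ?_⟩
  -- local formula on `u_v`
  have hform : ∀ v ∈ allStrings K, ∀ r ∈ B, EA.le r (uw EA CB a v) →
      Ut r ((2 ^ K) • φ a - M • u) + M • φ r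
        = Ut r (φ (cw EA CB a v)) + hpN v.reverse • φ r := by
    intro v hv r hr hrv
    obtain ⟨h1, h2, h3, h4, h5⟩ := hp_inv S hspec ha v.reverse
    have h4' := congrArg (Ut r) h4
    rw [List.length_reverse, hp_len K v hv, S.Uadd _ hr, S.Unsmul hr, S.Unsmul hr,
      S.Ucomp_le hr h1 hrv, ← S.Uu h1, S.Ucomp_le hr h1 hrv, S.Uu hr] at h4'
    rw [S.Usub hr, S.Unsmul hr, S.Unsmul hr, S.Uu hr, sub_add_cancel, ← h4']
    rfl
  have hneg : Ut D ((2 ^ K) • φ a - M • u) ≤ 0 := by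
    rw [hDU]
    apply add_nonpos
    · rw [S.Usub hscB, S.Unsmul hscB, S.UJ _ hscB a ha,
        hp_Jcompl_zero CB (hB.1 hsB) (hp_cover_le CB hspec.1 a), S.zero, smul_zero, zero_sub,
        S.Unsmul hscB, S.Uu hscB]
      exact neg_nonpos.2 (nsmul_nonneg (S.mem _ (hp_B_C CB hB hscB)).1 _)
    · apply hp_sum_nonpos
      intro g hg
      simp only [List.mem_map] at hg
      obtain ⟨v, hv, rfl⟩ := hg
      rw [hF, List.mem_filter] at hv
      have hle := (hM' v hv.1).1 (by simpa using hv.2)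
      simp only [Function.comp]
      have h := hform v hv.1 _ (huB v) (hp_le_refl EA _)
      obtain ⟨h1, h2, h3, h4, h5⟩ := hp_inv S hspec ha v.reverse
      have h6 : Ut (uw EA CB a v) (φ (cw EA CB a v)) ≤ φ (uw EA CB a v) := by
        refine (S.Ule (huB v) (S.mem _ h2).1).trans ?_
        exact (S.le_iff h2 (huC v)).1 h3
      have h7 : (hpN v.reverse + 1) • φ (uw EA CB a v) ≤ M • φ (uw EA CB a v) :=
        nsmul_le_nsmul_left (S.mem _ (huC v)).1 hle
      rw [add_smul, one_smul, add_comm] at h7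
      have h8 := (add_le_add h6 (le_refl (hpN v.reverse • φ (uw EA CB a v)))).trans h7
      rw [← h] at h8
      simpa using h8
  intro p hp
  constructor
  · intro hpD
    rw [← S.Ucomp_le hp hDB hpD]
    exact S.Unonpos hp hneg
  · intro hpn
    have hz : ∀ v ∈ F', Ut p (φ (uw EA CB a v)) = 0 := by
      intro v hv
      rw [hF', List.mem_filter] at hv
      have hle : M ≤ hpN v.reverse := by
        have : ¬ (hpN v.reverse + 1 ≤ M) := by
          rw [← hM' v hv.1]; simpa using hv.2
        omega
      rw [S.UJ p hp _ (huC v)]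
      have hrB := hp_B_J CB hB hp (huB v)
      have hr1 : EA.le (CB.J p (uw EA CB a v)) (uw EA CB a v) := by
        exact hp_le_left EA (huC v p hp)
      have hr2 : EA.le (CB.J p (uw EA CB a v)) p := hp_Jle CB (hB.1 hp) _
      set r := CB.J p (uw EA CB a v)
      have h := hform v hv.1 r hrB hr1
      obtain ⟨h1, h2, h3, h4, h5⟩ := hp_inv S hspec ha v.reverse
      have hn : Ut r ((2 ^ K) • φ a - M • u) ≤ 0 := by
        rw [← S.Ucomp_le hrB hp hr2]; exact S.Unonpos hrB hpn
      have h7 : M • φ r ≤ hpN v.reverse • φ r :=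
        nsmul_le_nsmul_left (S.mem _ (hp_B_C CB hB hrB)).1 hle
      have h8 : Ut r (φ (cw EA CB a v)) ≤ 0 := by
        have h9 : Ut r (φ (cw EA CB a v)) + hpN v.reverse • φ r ≤ 0 + hpN v.reverse • φ r := by
          rw [← h]; exact add_le_add hn h7
        exact le_of_add_le_add_right h9
      have h10 := h5 r hrB hr1 (le_antisymm h8 (S.Unonneg hrB (S.mem _ h2).1))
      rw [h10, S.zero]
    rw [S.le_iff (hp_B_C CB hB hp) (hp_B_C CB hB hDB), ← S.Uu hp, ← hs1, ← htot]
    have hz' : Ut p (F'.map fun v => φ (uw EA CB a v)).sum = 0 := by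
      rw [S.Usum hp, List.map_map]
      apply List.sum_eq_zero
      intro g hg
      obtain ⟨v, hv, rfl⟩ := List.mem_map.1 hg
      exact hz v hv
    have : (F.map fun v => φ (uw EA CB a v)).sum + (F'.map fun v => φ (uw EA CB a v)).sum
        + φ (EA.compl s) = φ D + (F'.map fun v => φ (uw EA CB a v)).sum := by
      rw [hDφ]
      simp only [Function.comp_def]
      abel
    rw [this, S.Uadd _ hp, hz', add_zero]
    exact S.Ule hp (S.mem _ (hp_B_C CB hB hDB)).1

/-- disjointness in lattice ordered groups -/
theorem hp_disj {x y z : G} (hx : 0 ≤ x) (hy : 0 ≤ y) (hz : 0 ≤ z) (h1 : x ⊓ y = 0)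
    (h2 : x ⊓ z = 0) : x ⊓ (y + z) = 0 := by
  apply le_antisymm _ (le_inf hx (add_nonneg hy hz))
  have h3 : x ⊓ (y + z) ≤ z := by
    have : x ⊓ (y + z) ≤ (x ⊓ y) + z := by
      rw [inf_add]
      exact inf_le_inf (le_add_of_nonneg_right hz) le_rfl
    rwa [h1, zero_add] at this
  rw [← h2]; exact le_inf inf_le_left h3

theorem hp_disj_nsmul {x y : G} (hx : 0 ≤ x) (hy : 0 ≤ y) (h : x ⊓ y = 0) (n : ℕ) :
    x ⊓ (n • y) = 0 := by
  induction n with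
  | zero => simpa using hx
  | succ n ih => rw [succ_nsmul]; exact hp_disj hx (nsmul_nonneg hy n) hy ih h

theorem hp_semiclosed {x : G} {n : ℕ} (hn : 0 < n) : n • x ≤ 0 ↔ x ≤ 0 := by
  refine ⟨fun h => ?_, fun h => nsmul_nonpos h n⟩
  have hp := posPart_nonneg x
  have hm := negPart_nonneg x
  have h0 : x⁺ ⊓ x⁻ = 0 := posPart_inf_negPart_eq_zero x
  have h1 := hp_disj_nsmul hp hm h0 n
  have h2 : n • x⁺ ≤ n • x⁻ := by
    rw [← sub_nonpos, ← smul_sub, posPart_sub_negPart]; exact h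
  have h3 : x⁺ ≤ n • x⁺ := by
    conv_lhs => rw [← one_smul ℕ x⁺]
    exact nsmul_le_nsmul_left hp hn
  have h4 : x⁺ ≤ 0 := by
    rw [← h1]; exact le_inf le_rfl (h3.trans h2)
  exact (le_posPart x).trans h4

theorem hp_dyadic_string (K : ℕ) : ∀ k : ℕ, 0 < k → k < 2 ^ K →
    ∃ w : List Bool, lamOf (w ++ [true]) = (k : ℚ) / 2 ^ K := by
  induction K with
  | zero => intro k h1 h2; simp at h2; omega
  | succ K ih =>
    intro k h1 h2
    rcases Nat.even_or_odd' k with ⟨j, rfl | rfl⟩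
    · obtain ⟨w, hw⟩ := ih j (by omega) (by rw [pow_succ] at h2; omega)
      refine ⟨w, ?_⟩
      rw [hw, pow_succ]; push_cast; field_simp
    · have hj : j < 2 ^ K := by rw [pow_succ] at h2; omega
      obtain ⟨v, hv1, hv2⟩ : ∃ v : List Bool, v.length = K ∧ hpN v = j := by
        clear ih h1 h2
        induction K generalizing j with
        | zero => exact ⟨[], rfl, by simp at hj; simp [hpN, hj]⟩
        | succ K ih =>
          rcases Nat.even_or_odd' j with ⟨i, rfl | rfl⟩
          · obtain ⟨v, h1, h2⟩ := ih i (by rw [pow_succ] at hj; omega)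
            exact ⟨false :: v, by simp [h1], by simp [hpN, h2]⟩
          · obtain ⟨v, h1, h2⟩ := ih i (by rw [pow_succ] at hj; omega)
            exact ⟨true :: v, by simp [h1], by simp [hpN, h2]⟩
      refine ⟨v.reverse, ?_⟩
      rw [hp_lam_append, hp_lam_N, List.length_reverse, hv1, hv2, pow_succ]
      push_cast
      simp only [if_true]
      field_simp

theorem hp_main {u : G} {φ : E → G} {Ut : E → G → G} (S : HpG CB B u φ Ut)
    (hspec : Spectral EA CB) {a : E} (ha : a ∈ Cblock EA CB B) (lam : ℚ) (hlam : Dyadic01 lam)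
    (m n : ℕ) (hn : 0 < n) (hmn : lam = (m : ℚ) / (n : ℚ)) :
    pdyad EA CB a lam ∈ B ∧ ∀ p ∈ B, (EA.le p (pdyad EA CB a lam) ↔
      Ut p (n • φ a - m • u) ≤ 0) := by
  have hB := S.hB
  have hn' : (0 : ℚ) < n := by exact_mod_cast hn
  unfold pdyad
  split_ifs with h0 h1 h2
  · have hm0 : m = 0 := by
      rw [hmn, div_le_iff₀ hn', zero_mul] at h0
      have : m ≤ 0 := by exact_mod_cast h0
      omega
    subst hm0
    have hsB := hp_B_cover CB hB hspec.1 ha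
    refine ⟨hp_B_compl CB hB hsB, fun p hp => ?_⟩
    have hpP := hB.1 hp
    rw [zero_smul, sub_zero, S.Unsmul hp, hp_semiclosed hn, S.UJ p hp a ha]
    have hJ := hp_C_J CB hB hp ha
    have e1 : φ (CB.J p a) ≤ 0 ↔ CB.J p a = EA.zero := by
      rw [← S.zero, ← S.le_iff hJ (hp_C_zero CB hB)]
      exact ⟨hp_le_zero EA, fun h => by rw [h]; exact hp_le_refl EA _⟩
    rw [e1, hp_Jzero_iff CB hpP, (hp_cover_spec CB hspec.1 a).2 _ (hp_Pcompl CB hpP)]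
    exact ⟨hp_le_compl_comm EA, hp_le_compl_comm EA⟩
  · have hle : lam ≤ 1 := by
      obtain ⟨N, k, hk, rfl⟩ := hlam
      rw [div_le_one (by positivity)]; exact hk
    have hl1 : lam = 1 := le_antisymm hle h1
    have hm : m = n := by
      rw [hl1, eq_div_iff hn'.ne', one_mul] at hmn
      exact_mod_cast hmn.symm
    subst hm
    refine ⟨hp_B_one CB hB, fun p hp => ⟨fun _ => ?_, fun _ => hp_le_one EA p⟩⟩
    apply S.Unonpos hp
    rw [← smul_sub]
    exact nsmul_nonpos (sub_nonpos.2 (S.mem a ha).2) _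
  · have hw := h2.choose_spec
    set w := h2.choose
    have hM : lamOf (w ++ [true]) = (hpN (w ++ [true]).reverse : ℚ) / 2 ^ (w.length + 1) := by
      rw [hp_lam_N']; simp
    set M := hpN (w ++ [true]).reverse
    obtain ⟨h3, h4⟩ := hp_pbin S hspec ha w M hM
    refine ⟨h3, fun p hp => ?_⟩
    rw [h4 p hp, ← hp_semiclosed hn, ← S.Unsmul hp,
      ← hp_semiclosed (x := Ut p (n • φ a - m • u)) (n := 2 ^ (w.length + 1)) (by positivity),
      ← S.Unsmul hp]
    have hMm : n * M = 2 ^ (w.length + 1) * m := by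
      rw [hw, hmn, div_eq_div_iff hn'.ne' (by positivity)] at hM
      have : m * 2 ^ (w.length + 1) = M * n := by exact_mod_cast hM
      rw [mul_comm n, ← this, mul_comm]
    rw [smul_sub, smul_sub, ← mul_smul, ← mul_smul, ← mul_smul, ← mul_smul, hMm, mul_comm n]
  · exfalso
    obtain ⟨N, k, hk, rfl⟩ := hlam
    push Not at h0 h1
    apply h2
    have hpos : (0 : ℚ) < 2 ^ N := by positivity
    rw [div_lt_one hpos] at h1
    have hk0 : (0 : ℚ) < k := by
      by_contra h
      have : (k : ℚ) = 0 := le_antisymm (not_lt.1 h) (by positivity)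
      simp [this] at h0
    exact hp_dyadic_string N k (by exact_mod_cast hk0) (by exact_mod_cast h1)

end Grp

end EffectAlgebra


open EffectAlgebra in
/-- for a spectral effect algebra `E` and `a ∈ E`, for every C-block `C`
containing `a` (with universal group `(G,u)`, iso `φ : C → [0,u]`, extended compressions
`Ũ_p = Ut p` and Rickart mapping `rick`), and every dyadic rational `λ = m/n ∈ [0,1]`,
the rational spectral projection `p^C_{a,λ} = ((n·a − m·u)_+)^*` computed in `G` equals
the binary spectral projection `p_{a,λ}`; in particular it does not depend on `C`. -/
theorem statement11 {E : Type u} (EA : EffectAlgebra E) (CB : CompressionBase EA)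
    (hspec : Spectral EA CB) (a : E)
    (B : Set E) (hB : IsBlock EA CB B) (haC : a ∈ Cblock EA CB B)
    {G : Type u} [AddCommGroup G] [Lattice G] [CovariantClass G G (· + ·) (· ≤ ·)]
    (u : G) (hu : 0 ≤ u ∧ ∀ g : G, ∃ n : ℕ, g ≤ n • u)
    (φ : E → G) (hφ1 : φ EA.one = u)
    (hmem : ∀ x ∈ Cblock EA CB B, 0 ≤ φ x ∧ φ x ≤ u)
    (hinj : ∀ x ∈ Cblock EA CB B, ∀ y ∈ Cblock EA CB B, φ x = φ y → x = y)
    (hsurj : ∀ g : G, 0 ≤ g → g ≤ u → ∃ x ∈ Cblock EA CB B, φ x = g)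
    (hadd : ∀ x ∈ Cblock EA CB B, ∀ y ∈ Cblock EA CB B, ∀ z : E,
      EA.padd x y = some z → φ z = φ x + φ y)
    (hadd' : ∀ x ∈ Cblock EA CB B, ∀ y ∈ Cblock EA CB B, φ x + φ y ≤ u →
      ∃ z : E, EA.padd x y = some z)
    (huniv : ∀ (H : Type u) [AddCommGroup H], ∀ ψ : E → H,
      (∀ x ∈ Cblock EA CB B, ∀ y ∈ Cblock EA CB B, ∀ z : E, EA.padd x y = some z →
        ψ z = ψ x + ψ y) →
      ∃! h : G → H, (∀ g g' : G, h (g + g') = h g + h g') ∧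
        ∀ x ∈ Cblock EA CB B, h (φ x) = ψ x)
    (Ut : E → G → G)
    (hUt : ∀ p ∈ B, (∀ g g' : G, Ut p (g + g') = Ut p g + Ut p g') ∧
      (∀ g g' : G, g ≤ g' → Ut p g ≤ Ut p g') ∧
      ∀ x ∈ Cblock EA CB B, Ut p (φ x) = φ (CB.J p x))
    (rick : G → E)
    (hrick : ∀ g : G, rick g ∈ B ∧ ∀ p ∈ B,
      (EA.le p (rick g) ↔ (g = Ut p g + Ut (EA.compl p) g ∧ Ut p g = 0)))
    :
    ∀ lam : ℚ, Dyadic01 lam → ∀ m n : ℕ, 0 < n → lam = (m : ℚ) / (n : ℚ) →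
      rick ((n • φ a - m • u) ⊔ 0) = pdyad EA CB a lam := by
  have : IsOrderedAddMonoid G :=
    { add_le_add_left := fun a b h c => by
        have := CovariantClass.elim (μ := ((· + ·) : G → G → G)) (r := (· ≤ ·)) c h
        simpa only [add_comm] using this }
  have S : HpG CB B u φ Ut :=
    { hB := hB, one := hφ1, mem := hmem, inj := hinj, surj := hsurj, add := hadd, add' := hadd'
      uniq := by
        intro f g hf hg hfg
        obtain ⟨h, -, hh⟩ := huniv G (fun x => f (φ x)) (by
          intro x hx y hy z hz
          rw [hadd x hx y hy z hz, hf])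
        rw [hh f ⟨hf, fun _ _ => rfl⟩, hh g ⟨hg, fun x hx => (hfg x hx).symm⟩]
      Uadd := fun p hp => (hUt p hp).1
      Umono := fun p hp => (hUt p hp).2.1
      UJ := fun p hp => (hUt p hp).2.2 }
  intro lam hlam m n hn hmn
  obtain ⟨h1, h2⟩ := hp_main S hspec haC lam hlam m n hn hmn
  obtain ⟨h3, h4⟩ := hrick ((n • φ a - m • u) ⊔ 0)
  apply hp_le_antisymm EA
  · rw [h2 _ h3, ← S.pos_iff h3, ← h4 _ h3]; exact hp_le_refl EA _
  · rw [h4 _ h1, S.pos_iff h1, ← h2 _ h1]; exact hp_le_refl EA _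
end

section
/- Let E be a spectral effect algebra. Then the following are equivalent: (a) for every a ∈ E and every dyadic rational λ ∈ [0,1), the binary spectral resolution satisfies p_{a,λ} = ⋀_{μ>λ} p_{a,μ}, the infimum taken over dyadic rationals μ ∈ [0,1] with μ > λ; (b) E is archimedean. -/
/- Common definitions: effect algebras, compression bases, spectrality -/

attribute [local instance 0] Classical.propDecidable

universe u

namespace SP
open EffectAlgebra

section
variable {E : Type u}

/-- `E` with an absorbing element adjoined: a total commutative monoid. -/
def OE (_ : EffectAlgebra E) : Type u := Option E

variable {EA : EffectAlgebra E}

def ii (EA : EffectAlgebra E) (a : E) : OE EA := (some a : Option E)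

theorem ii_inj {a b : E} (h : ii EA a = ii EA b) : a = b := Option.some.inj h

def oadd (x y : OE EA) : OE EA :=
  Option.bind (x : Option E) fun a => Option.bind (y : Option E) fun b => EA.padd a b

theorem oadd_some {x y : OE EA} {c : E} (h : oadd x y = ii EA c) :
    ∃ a b, x = ii EA a ∧ y = ii EA b ∧ EA.padd a b = some c := by
  cases x with
  | none => exact absurd h (by simp [oadd, ii])
  | some a =>
    cases y with
    | none => exact absurd h (by simp [oadd, ii])
    | some b => exact ⟨a, b, rfl, rfl, h⟩

theorem oadd_comm (x y : OE EA) : oadd x y = oadd y x := by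
  cases x with
  | none => cases y <;> rfl
  | some a =>
    cases y with
    | none => rfl
    | some b => exact EA.comm a b

theorem oadd_assoc1 {x y z : OE EA} {c : E} (h : oadd (oadd x y) z = ii EA c) :
    oadd x (oadd y z) = ii EA c := by
  obtain ⟨ab, z', h1, rfl, h2⟩ := oadd_some h
  obtain ⟨a, b, rfl, rfl, h3⟩ := oadd_some h1
  obtain ⟨bc, h4, h5⟩ := EA.assoc _ _ _ _ _ h3 h2
  have : oadd (ii EA b) (ii EA z') = ii EA bc := h4
  rw [this]; exact h5

theorem oadd_assoc (x y z : OE EA) : oadd (oadd x y) z = oadd x (oadd y z) := by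
  have key : ∀ c : E, oadd (oadd x y) z = ii EA c ↔ oadd x (oadd y z) = ii EA c := by
    intro c
    constructor
    · exact oadd_assoc1
    · intro h
      rw [oadd_comm (oadd x y) z, oadd_comm x y]
      apply oadd_assoc1
      rw [oadd_comm (oadd z y) x, oadd_comm z y]; exact h
  exact Option.ext key

theorem padd_zero (a : E) : EA.padd a EA.zero = some a := by
  obtain ⟨x, hx⟩ := EA.orth_exists EA.one
  have hx0 : x = EA.zero := EA.add_one x _ (by rw [EA.comm]; exact hx)
  subst hx0
  obtain ⟨a', ha⟩ := EA.orth_exists a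
  rw [EA.comm] at ha
  obtain ⟨bc, h1, h2⟩ := EA.assoc _ _ _ _ _ ha hx
  rw [h1]
  rw [EA.orth_unique _ _ _ h2 ha]

theorem zero_oadd (x : OE EA) : oadd (ii EA EA.zero) x = x := by
  rw [oadd_comm]
  cases x with
  | none => rfl
  | some a => exact padd_zero a

instance : Zero (OE EA) := ⟨ii EA EA.zero⟩

instance : Add (OE EA) := ⟨oadd⟩

instance : AddCommMonoid (OE EA) where
  add_assoc := oadd_assoc
  add_comm := oadd_comm
  zero_add := zero_oadd
  add_zero x := by
    show oadd x (ii EA EA.zero) = x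
    rw [oadd_comm]; exact zero_oadd x
  nsmul := nsmulRec

theorem ii_zero : ii EA EA.zero = 0 := rfl

theorem padd_iff {a b c : E} : EA.padd a b = some c ↔ ii EA a + ii EA b = ii EA c := Iff.rfl

theorem add_def {x y : OE EA} {c : E} (h : x + y = ii EA c) :
    ∃ a b, x = ii EA a ∧ y = ii EA b := by
  obtain ⟨a, b, h1, h2, _⟩ := oadd_some (show oadd x y = ii EA c from h)
  exact ⟨a, b, h1, h2⟩

theorem le_iff {a b : E} : EA.le a b ↔ ∃ x : OE EA, ii EA a + x = ii EA b := by
  constructor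
  · rintro ⟨c, hc⟩; exact ⟨ii EA c, hc⟩
  · rintro ⟨x, hx⟩
    obtain ⟨_, c, _, rfl⟩ := add_def hx
    exact ⟨c, hx⟩

theorem compl_add (a : E) : ii EA a + ii EA (EA.compl a) = ii EA EA.one :=
  (EA.orth_exists a).choose_spec

theorem le_one (a : E) : EA.le a EA.one := ⟨_, compl_add a⟩

theorem compl_unique {a x : E} (h : ii EA a + ii EA x = ii EA EA.one) : x = EA.compl a :=
  EA.orth_unique _ _ _ h (compl_add a)

theorem cancel {a c : E} {x y : OE EA} (hx : ii EA a + x = ii EA c)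
    (hy : ii EA a + y = ii EA c) : x = y := by
  obtain ⟨_, x, _, rfl⟩ := add_def hx
  obtain ⟨_, y, _, rfl⟩ := add_def hy
  have key : ∀ z, ii EA a + ii EA z = ii EA c →
      ii EA (EA.compl c) + ii EA a + ii EA z = ii EA EA.one := by
    intro z hz
    rw [add_assoc, hz, add_comm, compl_add]
  have h1 := key x hx
  have h2 := key y hy
  obtain ⟨t, _, ht, _⟩ := add_def h1
  rw [ht] at h1 h2
  rw [EA.orth_unique _ _ _ h1 h2]

theorem cancel_ii {a c x y : E} (hx : ii EA a + ii EA x = ii EA c)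
    (hy : ii EA a + ii EA y = ii EA c) : x = y := ii_inj (cancel hx hy)

theorem le_refl (a : E) : EA.le a a := ⟨EA.zero, padd_zero a⟩

theorem zero_le (a : E) : EA.le EA.zero a := le_iff.2 ⟨ii EA a, by rw [ii_zero, zero_add]⟩

theorem le_trans {a b c : E} (h1 : EA.le a b) (h2 : EA.le b c) : EA.le a c := by
  rw [le_iff] at *
  obtain ⟨x, hx⟩ := h1
  obtain ⟨y, hy⟩ := h2
  exact ⟨x + y, by rw [← add_assoc, hx, hy]⟩

theorem add_eq_zero {x y : OE EA} (h : x + y = 0) : x = 0 := by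
  obtain ⟨a, b, rfl, rfl⟩ := add_def (c := EA.zero) h
  have : ii EA b + ii EA EA.one = ii EA EA.one := by
    have h1 : ii EA a + ii EA b + ii EA EA.one = ii EA EA.one := by rw [h, zero_add]
    have h2 : ii EA a + (ii EA b + ii EA EA.one) = ii EA EA.one := by rw [← add_assoc, h1]
    obtain ⟨_, t, _, ht⟩ := add_def h2
    have hb : b = EA.zero := EA.add_one b t ht
    rw [hb, ii_zero, zero_add]
  have hb : b = EA.zero := EA.add_one b _ this
  rw [hb, ii_zero, add_zero] at h
  exact h

theorem le_zero {a : E} (h : EA.le a EA.zero) : a = EA.zero := by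
  obtain ⟨x, hx⟩ := le_iff.1 h
  exact ii_inj (add_eq_zero hx)

theorem le_antisymm {a b : E} (h1 : EA.le a b) (h2 : EA.le b a) : a = b := by
  rw [le_iff] at *
  obtain ⟨x, hx⟩ := h1
  obtain ⟨y, hy⟩ := h2
  have : ii EA a + (x + y) = ii EA a := by rw [← add_assoc, hx, hy]
  have h0 : x + y = 0 := cancel this (add_zero _)
  rw [add_eq_zero h0, add_zero] at hx
  exact ii_inj hx

theorem compl_compl (a : E) : EA.compl (EA.compl a) = a := by
  symm; apply compl_unique; rw [add_comm]; exact compl_add a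

/-- orthogonality -/
theorem le_compl_iff {a b : E} : EA.le a (EA.compl b) ↔ ∃ c, ii EA a + ii EA b = ii EA c := by
  constructor
  · intro h
    obtain ⟨x, hx⟩ := le_iff.1 h
    have : (ii EA a + ii EA b) + x = ii EA EA.one := by
      rw [add_right_comm, hx, add_comm, compl_add]
    obtain ⟨c, _, hc, _⟩ := add_def this
    exact ⟨c, hc⟩
  · rintro ⟨c, hc⟩
    have h1 : ii EA b + (ii EA a + ii EA (EA.compl c)) = ii EA EA.one := by
      rw [← add_assoc, add_comm (ii EA b), hc, compl_add]
    exact le_iff.2 ⟨_, cancel h1 (compl_add b)⟩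

theorem compl_anti {a b : E} (h : EA.le a b) : EA.le (EA.compl b) (EA.compl a) := by
  obtain ⟨x, hx⟩ := le_iff.1 h
  rw [le_compl_iff]
  have : (ii EA (EA.compl b) + ii EA a) + x = ii EA EA.one := by
    rw [add_assoc, hx, add_comm, compl_add]
  obtain ⟨c, _, hc, _⟩ := add_def this
  exact ⟨c, hc⟩

theorem osub_spec {a b : E} (h : EA.le a b) : ii EA a + ii EA (EA.osub b a) = ii EA b := by
  have h' : ∃ c, EA.padd a c = some b := h
  unfold osub
  rw [dif_pos h']
  exact h'.choose_spec

theorem osub_eq {a b c : E} (h : ii EA a + ii EA c = ii EA b) : EA.osub b a = c :=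
  cancel_ii (osub_spec (le_iff.2 ⟨_, h⟩)) h

theorem oplusD_eq {a b c : E} (h : ii EA a + ii EA b = ii EA c) : EA.oplusD a b = c := by
  have : EA.padd a b = some c := h
  simp [oplusD, this]

theorem le_of_add {a b c : E} (h : ii EA a + ii EA b = ii EA c) : EA.le a c := ⟨b, h⟩

theorem le_of_add' {a b c : E} (h : ii EA a + ii EA b = ii EA c) : EA.le b c :=
  ⟨a, by rw [add_comm] at h; exact h⟩

/-- smaller summands have a sum, which is smaller -/
theorem add_mono {a b a1 b1 c : E} (ha : EA.le a1 a) (hb : EA.le b1 b)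
    (h : ii EA a + ii EA b = ii EA c) :
    ∃ c1, ii EA a1 + ii EA b1 = ii EA c1 ∧ EA.le c1 c := by
  obtain ⟨x, hx⟩ := le_iff.1 ha
  obtain ⟨y, hy⟩ := le_iff.1 hb
  have : (ii EA a1 + ii EA b1) + (x + y) = ii EA c := by
    rw [add_add_add_comm, hx, hy, h]
  obtain ⟨c1, _, hc, _⟩ := add_def this
  refine ⟨c1, hc, le_iff.2 ⟨x + y, ?_⟩⟩
  rw [← hc, this]

theorem add_le_cancel {a b b1 c c1 : E} (h : ii EA a + ii EA b = ii EA c)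
    (h1 : ii EA a + ii EA b1 = ii EA c1) (hle : EA.le c c1) : EA.le b b1 := by
  obtain ⟨x, hx⟩ := le_iff.1 hle
  rw [← h, add_assoc] at hx
  exact le_iff.2 ⟨x, cancel hx h1⟩

theorem nsmulE_eq (n : ℕ) (a : E) : EA.nsmulE n a = (n • ii EA a : OE EA) := by
  induction n with
  | zero => rw [zero_nsmul]; rfl
  | succ n ih =>
    rw [succ_nsmul', nsmulE, ih]
    show _ = oadd _ _
    cases hh : (n • ii EA a : OE EA) <;> rfl

theorem nsmul_def_of_le {n m : ℕ} (hnm : n ≤ m) {a c : E} (h : m • ii EA a = ii EA c) :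
    ∃ b, n • ii EA a = ii EA b := by
  obtain ⟨k, rfl⟩ := Nat.exists_eq_add_of_le hnm
  rw [add_nsmul] at h
  obtain ⟨b, _, hb, _⟩ := add_def h
  exact ⟨b, hb⟩


/-! compressions -/

variable {CB : CompressionBase EA}

theorem J_add {p : E} (hp : p ∈ CB.P) {a b c : E} (h : ii EA a + ii EA b = ii EA c) :
    ii EA (CB.J p a) + ii EA (CB.J p b) = ii EA (CB.J p c) :=
  (CB.compr p hp).1.1 a b c h

theorem J_mono {p : E} (hp : p ∈ CB.P) {a b : E} (h : EA.le a b) :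
    EA.le (CB.J p a) (CB.J p b) := by
  obtain ⟨c, hc⟩ := h
  exact ⟨_, J_add hp hc⟩

theorem J_le {p : E} (hp : p ∈ CB.P) (a : E) : EA.le (CB.J p a) p := by
  have := J_mono (CB := CB) hp (le_one a)
  rwa [CB.focus p hp] at this

theorem J_of_le {p : E} (hp : p ∈ CB.P) {a : E} (h : EA.le a p) : CB.J p a = a := by
  apply (CB.compr p hp).1.2
  rwa [CB.focus p hp]

theorem J_zero_iff {p : E} (hp : p ∈ CB.P) {a : E} :
    CB.J p a = EA.zero ↔ EA.le a (EA.compl p) := by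
  have := (CB.compr p hp).2 a
  rwa [CB.focus p hp] at this

theorem P_zero : EA.zero ∈ CB.P := CB.sub.1
theorem P_compl {p : E} (hp : p ∈ CB.P) : EA.compl p ∈ CB.P := CB.sub.2.2.1 p hp
theorem P_add {p q c : E} (hp : p ∈ CB.P) (hq : q ∈ CB.P) (h : ii EA p + ii EA q = ii EA c) :
    c ∈ CB.P := CB.sub.2.2.2 p hp q hq c h

/-- projections are principal -/
theorem principal {p : E} (hp : p ∈ CB.P) {a b c : E} (ha : EA.le a p) (hb : EA.le b p)
    (h : ii EA a + ii EA b = ii EA c) : EA.le c p := by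
  have h1 := J_add hp h
  rw [J_of_le hp ha, J_of_le hp hb, h] at h1
  rw [ii_inj h1]; exact J_le hp c

theorem le_self_compl {p : E} (hp : p ∈ CB.P) (h : EA.le p (EA.compl p)) : p = EA.zero := by
  rw [← J_of_le hp (le_refl p)]
  exact (J_zero_iff hp).2 h

theorem P_sub {p q c : E} (hp : p ∈ CB.P) (hq : q ∈ CB.P) (h : ii EA p + ii EA c = ii EA q) :
    c ∈ CB.P := by
  have h1 : ii EA c + (ii EA p + ii EA (EA.compl q)) = ii EA EA.one := by
    rw [← add_assoc, add_comm (ii EA c), h, compl_add]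
  obtain ⟨_, t, _, ht⟩ := add_def h1
  have htP := P_add hp (P_compl hq) ht
  rw [ht, add_comm] at h1
  rw [compl_unique h1]
  exact P_compl htP

theorem P_osub {p q : E} (hp : p ∈ CB.P) (hq : q ∈ CB.P) (h : EA.le p q) :
    EA.osub q p ∈ CB.P := P_sub hp hq (osub_spec h)

/-- compression of the orthosupplement -/
theorem J_compl_of_le {q u v : E} (hq : q ∈ CB.P) (h : ii EA u + ii EA v = ii EA q) :
    CB.J q (EA.compl u) = v := by
  have h1 := J_add hq (compl_add u)
  rw [CB.focus q hq, J_of_le hq (le_of_add h)] at h1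
  exact cancel_ii h1 h

theorem le_of_le_compl {q u v s : E} (hq : q ∈ CB.P) (h : ii EA u + ii EA v = ii EA q)
    (hs : EA.le s q) (hsu : EA.le s (EA.compl u)) : EA.le s v := by
  have := J_mono hq hsu
  rwa [J_of_le hq hs, J_compl_of_le hq h] at this

theorem le_compl_of_add {u v q : E} (h : ii EA u + ii EA v = ii EA q) :
    EA.le u (EA.compl v) := le_compl_iff.2 ⟨_, h⟩

theorem le_compl_of_add' {u v q : E} (h : ii EA u + ii EA v = ii EA q) :
    EA.le v (EA.compl u) := le_compl_iff.2 ⟨q, by rw [add_comm]; exact h⟩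

theorem le_compl_symm {u v : E} (h : EA.le u (EA.compl v)) : EA.le v (EA.compl u) := by
  have := compl_anti h
  rwa [compl_compl] at this

theorem inC_of {p : E} (hp : p ∈ CB.P) {a a1 a2 : E} (h1 : EA.le a1 p)
    (h2 : EA.le a2 (EA.compl p)) (h : ii EA a1 + ii EA a2 = ii EA a) :
    inC EA CB a p ∧ CB.J p a = a1 ∧ CB.J (EA.compl p) a = a2 := by
  have e1 : CB.J p a = a1 := by
    have := J_add hp h
    rw [J_of_le hp h1, (J_zero_iff hp).2 h2, ii_zero, add_zero] at this
    exact (ii_inj this).symm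
  have e2 : CB.J (EA.compl p) a = a2 := by
    have := J_add (P_compl hp) h
    rw [J_of_le (P_compl hp) h2, (J_zero_iff (P_compl hp)).2 (by rwa [compl_compl]),
      ii_zero, zero_add] at this
    exact (ii_inj this).symm
  refine ⟨?_, e1, e2⟩
  unfold inC
  rw [e1, e2]; exact h

theorem inC_iff {p : E} (hp : p ∈ CB.P) {a : E} : inC EA CB a p ↔
    ∃ a1 a2, EA.le a1 p ∧ EA.le a2 (EA.compl p) ∧ ii EA a1 + ii EA a2 = ii EA a := by
  constructor
  · intro h
    exact ⟨_, _, J_le hp a, J_le (P_compl hp) a, h⟩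
  · rintro ⟨a1, a2, h1, h2, h⟩
    exact (inC_of hp h1 h2 h).1

theorem inC_le {p : E} (hp : p ∈ CB.P) {a : E} (h : EA.le a p) : inC EA CB a p :=
  (inC_iff hp).2 ⟨a, EA.zero, h, zero_le _, by rw [ii_zero, add_zero]⟩

theorem inC_le' {p : E} (hp : p ∈ CB.P) {a : E} (h : EA.le a (EA.compl p)) : inC EA CB a p :=
  (inC_iff hp).2 ⟨EA.zero, a, zero_le _, h, by rw [ii_zero, zero_add]⟩

theorem inC_compl {p : E} {a : E} (h : inC EA CB a p) :
    inC EA CB a (EA.compl p) := by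
  unfold inC at *
  rw [compl_compl, EA.comm]; exact h

theorem inC_add {p : E} (hp : p ∈ CB.P) {a b c : E} (ha : inC EA CB a p) (hb : inC EA CB b p)
    (h : ii EA a + ii EA b = ii EA c) : inC EA CB c p := by
  have h1 := J_add hp h
  have h2 := J_add (P_compl hp) h
  have ha' : ii EA (CB.J p a) + ii EA (CB.J (EA.compl p) a) = ii EA a := ha
  have hb' : ii EA (CB.J p b) + ii EA (CB.J (EA.compl p) b) = ii EA b := hb
  show ii EA (CB.J p c) + ii EA (CB.J (EA.compl p) c) = ii EA c
  rw [← h1, ← h2, add_add_add_comm, ha', hb', h]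

theorem inC_sub {p : E} (hp : p ∈ CB.P) {a b c : E} (ha : inC EA CB a p) (hc : inC EA CB c p)
    (h : ii EA a + ii EA b = ii EA c) : inC EA CB b p := by
  have h1 := J_add hp h
  have h2 := J_add (P_compl hp) h
  have ha' : ii EA (CB.J p a) + ii EA (CB.J (EA.compl p) a) = ii EA a := ha
  have hc' : ii EA (CB.J p c) + ii EA (CB.J (EA.compl p) c) = ii EA c := hc
  show ii EA (CB.J p b) + ii EA (CB.J (EA.compl p) b) = ii EA b
  rw [← h1, ← h2, add_add_add_comm, ha'] at hc'
  exact cancel hc' h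

theorem mackey_symm {p q : E} (h : EA.Mackey p q) : EA.Mackey q p := by
  obtain ⟨a, b, c, d, e, h1, h2, h3, h4⟩ := h
  exact ⟨b, a, c, d, e, by rw [EA.comm]; exact h1, h2, h4, h3⟩

theorem inC_of_mackey {p q : E} (hq : q ∈ CB.P) (h : EA.Mackey p q) : inC EA CB p q := by
  obtain ⟨a, b, c, d, e, h1, h2, h3, h4⟩ := h
  have h1' : ii EA a + ii EA b = ii EA d := h1
  have h2' : ii EA d + ii EA c = ii EA e := h2
  have h4' : ii EA b + ii EA c = ii EA q := h4
  have h3' : ii EA a + ii EA c = ii EA p := h3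
  rw [← h1', add_assoc, h4'] at h2'
  exact (inC_iff hq).2 ⟨c, a, le_of_add' h4', le_compl_iff.2 ⟨_, h2'⟩, by rw [add_comm, h3']⟩

theorem mackey_of_inC {p q : E} (hq : q ∈ CB.P) (h : inC EA CB p q) : EA.Mackey p q := by
  have h' : ii EA (CB.J q p) + ii EA (CB.J (EA.compl q) p) = ii EA p := h
  have h2 := J_add hq (compl_add p)
  rw [CB.focus q hq] at h2
  obtain ⟨e, he⟩ := le_compl_iff.1 (J_le (P_compl hq) p)
  have h3 : ii EA (CB.J (EA.compl q) p) + ii EA (CB.J q (EA.compl p)) + ii EA (CB.J q p)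
      = ii EA e := by
    rw [add_assoc, add_comm (ii EA (CB.J q (EA.compl p))), h2, he]
  obtain ⟨d, _, hd, _⟩ := add_def h3
  rw [hd] at h3
  refine ⟨CB.J (EA.compl q) p, CB.J q (EA.compl p), CB.J q p, d, e, hd, h3, ?_, ?_⟩
  · rw [EA.comm]; exact h
  · rw [EA.comm]; exact h2

theorem inC_symm {p q : E} (hp : p ∈ CB.P) (hq : q ∈ CB.P) (h : inC EA CB p q) :
    inC EA CB q p := inC_of_mackey hp (mackey_symm (mackey_of_inC hq h))

/-- commuting projections -/
theorem JJ {p q : E} (hp : p ∈ CB.P) (hq : q ∈ CB.P) (h : inC EA CB p q) :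
    CB.J q p ∈ CB.P ∧ CB.J p q = CB.J q p ∧ (∀ a, CB.J p (CB.J q a) = CB.J (CB.J q p) a) ∧
      (∀ a, CB.J q (CB.J p a) = CB.J (CB.J q p) a) := by
  have hm := mackey_of_inC hq h
  have e : CB.J p q = CB.J q p := by
    have h' : ii EA (CB.J q p) + ii EA (CB.J (EA.compl q) p) = ii EA p := h
    have h2 := J_add hq (compl_add p)
    rw [CB.focus q hq] at h2
    have h3 := J_add hp h2
    rw [J_of_le hp (le_of_add h'), (J_zero_iff hp).2, ii_zero, add_zero] at h3
    · exact (ii_inj h3).symm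
    · skip
      have h1 : inC EA CB EA.one q :=
        (inC_iff hq).2 ⟨q, EA.compl q, le_refl _, le_refl _, compl_add q⟩
      have hpq : inC EA CB (EA.compl p) q := inC_sub hq h h1 (compl_add p)
      exact le_of_add (show ii EA _ + ii EA _ = ii EA _ from hpq)
  obtain ⟨r, hr, hr'⟩ := CB.mackey p hp q hq hm
  obtain ⟨s, hs, hs'⟩ := CB.mackey q hq p hp (mackey_symm hm)
  have er : CB.J q p = r := by
    have := congrFun hr' EA.one
    simp only [Function.comp_apply] at this
    rwa [CB.focus q hq, CB.focus r hr, e] at this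
  have es : CB.J q p = s := by
    have := congrFun hs' EA.one
    simp only [Function.comp_apply] at this
    rwa [CB.focus p hp, CB.focus s hs] at this
  refine ⟨er ▸ hr, e, ?_, ?_⟩
  · intro a; rw [er]; exact congrFun hr' a
  · intro a; rw [es]; exact congrFun hs' a


theorem JJ_le {p q : E} (hp : p ∈ CB.P) (hq : q ∈ CB.P) (h : EA.le p q) (a : E) :
    CB.J p (CB.J q a) = CB.J p a := by
  have := (JJ hp hq (inC_le hq h)).2.2.1 a
  rwa [J_of_le hq h] at this

theorem rel {p q : E} (hp : p ∈ CB.P) (hq : q ∈ CB.P) (h : inC EA CB q p) :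
    CB.J p q ∈ CB.P ∧ EA.le (CB.J p q) q ∧
    (∀ x, EA.le x q → CB.J (CB.J p q) x = CB.J p x) ∧
    (∀ x, EA.le x q → CB.J (EA.osub q (CB.J p q)) x = CB.J (EA.compl p) x) := by
  have h' : ii EA (CB.J p q) + ii EA (CB.J (EA.compl p) q) = ii EA q := h
  have h1 := JJ hq hp h
  have h2 := JJ hq (P_compl hp) (inC_compl h)
  refine ⟨h1.1, le_of_add h', ?_, ?_⟩
  · intro x hx
    rw [← h1.2.2.2, J_of_le hq hx]
  · intro x hx
    rw [osub_eq h', ← h2.2.2.2, J_of_le hq hx]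

theorem inC_of_inCq {q r x : E} (hq : q ∈ CB.P) (hr : r ∈ CB.P) (hrq : EA.le r q)
    (h : inCq EA CB q x r) : inC EA CB x r :=
  (inC_iff hr).2 ⟨_, _, J_le hr x, le_trans (J_le (P_osub hr hq hrq) x)
    (le_compl_of_add' (osub_spec hrq)), h⟩

theorem cov_exists (hspec : Spectral EA CB) (a : E) : ∃ p, IsProjCover EA CB a p := hspec.1 a

theorem cov_le {a p : E} (h : IsProjCover EA CB a p) : EA.le a p := (h.2 p h.1).2 (le_refl _)

theorem cov_unique {a p q : E} (h : IsProjCover EA CB a p) (h' : IsProjCover EA CB a q) :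
    p = q :=
  le_antisymm ((h.2 q h'.1).1 (cov_le h')) ((h'.2 p h.1).1 (cov_le h))

theorem projCover_spec (hspec : Spectral EA CB) (a : E) :
    IsProjCover EA CB a (projCover EA CB a) := by
  unfold projCover
  rw [dif_pos (hspec.1 a)]
  exact (hspec.1 a).choose_spec

theorem mk_cov {a p : E} (hp : p ∈ CB.P) (ha : EA.le a p)
    (h : ∀ q ∈ CB.P, EA.le a q → EA.le p q) : IsProjCover EA CB a p :=
  ⟨hp, fun q hq => ⟨h q hq, fun hpq => le_trans ha hpq⟩⟩

theorem projCoverq_spec (hspec : Spectral EA CB) {q a : E} (hq : q ∈ CB.P) (ha : EA.le a q) :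
    IsProjCover EA CB a (projCoverq EA CB q a) := by
  obtain ⟨p, hp⟩ := hspec.1 a
  have hpq : EA.le p q := (hp.2 q hq).1 ha
  have hex : ∃ p, IsProjCoverq EA CB q a p :=
    ⟨p, ⟨hp.1, hpq⟩, fun s hs => hp.2 s hs.1⟩
  unfold projCoverq
  rw [dif_pos hex]
  have hsp := hex.choose_spec
  set r := hex.choose with hr
  have e : r = p := by
    apply le_antisymm
    · exact (hsp.2 p ⟨hp.1, hpq⟩).1 (cov_le hp)
    · exact (hp.2 r hsp.1.1).1 ((hsp.2 r hsp.1).2 (le_refl _))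
  rw [e]; exact hp

theorem pmeet_eq {p q m : E} (h : IsMeetP EA CB p q m) : pmeet EA CB p q = m := by
  have hex : ∃ m, IsMeetP EA CB p q m := ⟨m, h⟩
  unfold pmeet
  rw [dif_pos hex]
  obtain ⟨a1, a2, a3, a4⟩ := hex.choose_spec
  obtain ⟨b1, b2, b3, b4⟩ := h
  exact le_antisymm (b4 _ a1 a2 a3) (a4 _ b1 b2 b3)

theorem cov_comm (hspec : Spectral EA CB) {a A r : E} (hA : IsProjCover EA CB a A)
    (hr : r ∈ CB.P) (h : inC EA CB a r) : inC EA CB A r := by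
  obtain ⟨a1, a2, h1, h2, h3⟩ := (inC_iff hr).1 h
  obtain ⟨A1, hA1⟩ := hspec.1 a1
  obtain ⟨A2, hA2⟩ := hspec.1 a2
  have l1 : EA.le A1 r := (hA1.2 r hr).1 h1
  have l2 : EA.le A2 (EA.compl r) := (hA2.2 _ (P_compl hr)).1 h2
  obtain ⟨B, hB, _⟩ := add_mono l1 l2 (compl_add r)
  have hBP := P_add hA1.1 hA2.1 hB
  obtain ⟨a', ha', hle⟩ := add_mono (cov_le hA1) (cov_le hA2) hB
  rw [h3] at ha'
  rw [← ii_inj ha'] at hle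
  have hAB : EA.le A B := (hA.2 B hBP).1 hle
  have m1 : EA.le A1 A := (hA1.2 A hA.1).1 (le_trans (le_of_add h3) (cov_le hA))
  have m2 : EA.le A2 A := (hA2.2 A hA.1).1 (le_trans (le_of_add' h3) (cov_le hA))
  have hBA := principal hA.1 m1 m2 hB
  rw [le_antisymm hAB hBA]
  exact (inC_iff hr).2 ⟨A1, A2, l1, l2, hB⟩

theorem commute_aux {q c e : E} (hq : q ∈ CB.P) (h : ii EA c + ii EA e = ii EA q) :
    CommuteEl EA CB e c := by
  intro p hp r hr
  have hqe : q ∈ PC EA CB e := ⟨hq, inC_le hq (le_of_add' h)⟩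
  have hpq : inC EA CB q p := inC_symm hp.1.1 hq (hp.2 q hqe)
  have hcp : inC EA CB c p := inC_sub hp.1.1 hp.1.2 hpq (by rw [add_comm]; exact h)
  exact mackey_symm (mackey_of_inC hp.1.1 (hr.2 p ⟨hp.1.1, hcp⟩))

theorem Pleq_nonempty (hspec : Spectral EA CB) {q c e : E} (hq : q ∈ CB.P)
    (h : ii EA c + ii EA e = ii EA q) : (Pleq EA CB q e c).Nonempty := by
  obtain ⟨p, hp, hle1, hle2⟩ := hspec.2.2 e c (commute_aux hq h)
  have hpP := hp.1
  have hcq : EA.le c q := le_of_add h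
  have heq : EA.le e q := le_of_add' h
  have hqp : inC EA CB q p := by
    apply hp.2
    left
    refine ⟨hq, ?_⟩
    rintro x (rfl | rfl)
    · exact inC_le hq heq
    · exact inC_le hq hcq
  obtain ⟨hm, hmq, hr1, hr2⟩ := rel hpP hq hqp
  have key : ∀ x, EA.le x q → inC EA CB x p → inCq EA CB q x (CB.J p q) := by
    intro x hx hxp
    unfold inCq
    rw [hr1 x hx, hr2 x hx]; exact hxp
  refine ⟨CB.J p q, ⟨⟨hm, hmq⟩, ?_⟩, ?_, ?_⟩
  · rintro x (hx | (rfl | rfl))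
    · refine key x hx.1.2 (hp.2 x (Or.inl ⟨hx.1.1, ?_⟩))
      intro y hy
      exact inC_of_inCq hq hx.1.1 hx.1.2 (hx.2 y hy)
    · exact key _ heq (hp.2 _ (by simp))
    · exact key _ hcq (hp.2 _ (by simp))
  · rw [hr1 _ heq, hr1 _ hcq]; exact hle1
  · rw [hr2 _ heq, hr2 _ hcq]; exact hle2

/-- projections in the relative bicommutant commute with everything commuting with `c` -/
theorem Psetq_comm (hspec : Spectral EA CB) {q c e h r : E} (hcov : IsProjCover EA CB c q)
    (he : ii EA c + ii EA e = ii EA q) (hh : h ∈ Psetq EA CB q {e, c}) (hr : r ∈ CB.P)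
    (hcr : inC EA CB c r) : inC EA CB h r ∧ inC EA CB e r := by
  have hq := hcov.1
  have hcq : EA.le c q := le_of_add he
  have heq : EA.le e q := le_of_add' he
  have hqr : inC EA CB q r := cov_comm hspec hcov hr hcr
  have her : inC EA CB e r := inC_sub hr hcr hqr he
  refine ⟨?_, her⟩
  obtain ⟨hm, hmq, hr1, hr2⟩ := rel hr hq hqr
  have hmem : CB.J r q ∈ PCsetq EA CB q {e, c} := by
    refine ⟨⟨hm, hmq⟩, ?_⟩
    rintro x (rfl | rfl)
    · unfold inCq; rw [hr1 _ heq, hr2 _ heq]; exact her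
    · unfold inCq; rw [hr1 _ hcq, hr2 _ hcq]; exact hcr
  have h1 : inC EA CB (CB.J r q) h :=
    inC_of_inCq hq hh.1.1 hh.1.2 (hh.2 _ (Or.inl hmem))
  have h2 : inC EA CB r q := inC_symm hq hr hqr
  have e1 : CB.J q r = CB.J r q := (JJ hq hr hqr).2.1
  have h3 : ii EA (CB.J q r) + ii EA (CB.J (EA.compl q) r) = ii EA r := h2
  rw [e1] at h3
  have h4 : inC EA CB (CB.J (EA.compl q) r) h :=
    inC_le' hh.1.1 (le_trans (J_le (P_compl hq) r) (compl_anti hh.1.2))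
  exact inC_symm hr hh.1.1 (inC_add hh.1.1 h1 h4 h3)

theorem inC_J {c h r : E} (hh : h ∈ CB.P) (hr : r ∈ CB.P) (hhr : inC EA CB h r)
    (hc : inC EA CB c r) : inC EA CB (CB.J h c) r := by
  have h1 := J_add hh (show ii EA _ + ii EA _ = ii EA _ from hc)
  have a1 := JJ hh hr hhr
  have a2 := JJ hh (P_compl hr) (inC_compl hhr)
  show ii EA _ + ii EA _ = ii EA _
  rw [a1.2.2.2, ← a1.2.2.1, a2.2.2.2, ← a2.2.2.1]
  exact h1

theorem inC_of_forall (hspec : Spectral EA CB) {c D : E} (hD : D ∈ CB.P)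
    (h : ∀ r ∈ CB.P, inC EA CB c r → inC EA CB D r) : inC EA CB c D := by
  obtain ⟨B, hB, hB2⟩ := hspec.2.1 c
  rw [hB2 D hD]
  intro b hb
  have hbP := hB.1 hb
  refine inC_symm hD hbP (h b hbP ?_)
  rw [hB2 b hbP]
  intro b1 hb1
  obtain ⟨p1, _, q1, _, c1, _, d, e, h1, h2, h3, h4⟩ := hB.2.2 b1 hb1 b hb
  exact inC_of_mackey hbP ⟨p1, q1, c1, d, e, h1, h2, h3, h4⟩

theorem posPartq_spec (hspec : Spectral EA CB) {q c e : E} (hq : q ∈ CB.P)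
    (he : ii EA c + ii EA e = ii EA q) :
    ∃ h ∈ Pleq EA CB q e c,
      ii EA (CB.J h e) + ii EA (posPartq EA CB q e c) = ii EA (CB.J h c) := by
  have hne := Pleq_nonempty hspec hq he
  refine ⟨hne.some, hne.some_mem, ?_⟩
  unfold posPartq
  rw [dif_pos hne]
  exact osub_spec hne.some_mem.2.1

theorem step (hspec : Spectral EA CB) {q c d u0 u1 x : E} (hcov : IsProjCover EA CB c q)
    (hd : d = posPartq EA CB q (EA.osub q c) c)
    (hu0 : u0 = pmeet EA CB (EA.osub q (projCoverq EA CB q d)) q)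
    (hu1 : u1 = pmeet EA CB q (EA.compl u0))
    (hx : x = EA.oplusD (CB.J u0 c) (CB.J u0 c)) :
    IsProjCover EA CB x u0 ∧ IsProjCover EA CB d u1 ∧ ii EA u0 + ii EA u1 = ii EA q ∧
      ii EA (CB.J u0 c) + ii EA (CB.J u0 c) = ii EA x := by
  have hq := hcov.1
  have he := osub_spec (cov_le hcov)
  set e := EA.osub q c
  obtain ⟨h, hh, hdd⟩ := posPartq_spec hspec hq he
  rw [← hd] at hdd
  have hhP : h ∈ CB.P := hh.1.1.1
  have hhq : EA.le h q := hh.1.1.2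
  have hdh : EA.le d h := le_trans (le_of_add' hdd) (J_le hhP _)
  have hdq : EA.le d q := le_trans hdh hhq
  have hD := projCoverq_spec hspec hq hdq
  set D := projCoverq EA CB q d
  have hDh : EA.le D h := (hD.2 h hhP).1 hdh
  have hDq : EA.le D q := le_trans hDh hhq
  have hDs := osub_spec hDq
  have hsP := P_osub hD.1 hq hDq
  have eu0 : u0 = EA.osub q D := by
    rw [hu0]
    exact pmeet_eq ⟨hsP, le_refl _, le_of_add' hDs, fun s _ h1 _ => h1⟩
  rw [← eu0] at hDs hsP
  have hDs' : ii EA u0 + ii EA D = ii EA q := by rw [add_comm]; exact hDs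
  have eu1 : u1 = D := by
    rw [hu1]
    exact pmeet_eq ⟨hD.1, hDq, le_compl_of_add hDs, fun s hs h1 h2 =>
      le_of_le_compl hq hDs' h1 h2⟩
  have hcD : inC EA CB c D := by
    apply inC_of_forall hspec hD.1
    intro r hr hcr
    obtain ⟨k1, k2⟩ := Psetq_comm hspec hcov he hh.1 hr hcr
    apply cov_comm hspec hD hr
    exact inC_sub hr (inC_J hhP hr k1 k2) (inC_J hhP hr k1 hcr) hdd
  have hle : EA.le (CB.J u0 c) (CB.J u0 e) := by
    have ce : ii EA (CB.J h e) + ii EA (CB.J (EA.osub q h) e) = ii EA e :=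
      hh.1.2 e (by simp)
    have cc : ii EA (CB.J h c) + ii EA (CB.J (EA.osub q h) c) = ii EA c :=
      hh.1.2 c (by simp)
    have t1 := J_add hsP hdd
    rw [(J_zero_iff hsP).2 (le_trans (cov_le hD) (le_compl_of_add hDs)), ii_zero,
      add_zero] at t1
    have t1 := ii_inj t1
    have t2 := J_mono hsP hh.2.2
    have t3 := J_add hsP ce
    have t4 := J_add hsP cc
    rw [← t1] at t4
    obtain ⟨y, hy, hyl⟩ := add_mono (le_refl _) t2 t3
    rw [t4] at hy
    rw [ii_inj hy]; exact hyl
  have hsum := J_add hsP he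
  obtain ⟨y, hy, hyl⟩ := add_mono (le_refl (CB.J u0 c)) hle hsum
  have hyx : x = y := by rw [hx]; exact oplusD_eq hy
  rw [← hyx] at hy hyl
  have hxu : EA.le x u0 := le_trans hyl (J_le hsP q)
  refine ⟨mk_cov hsP hxu ?_, by rw [eu1]; exact hD, by rw [eu1]; exact hDs', hy⟩
  intro s hs hxs
  obtain ⟨c1, c2, l1, l2, hc12⟩ := (inC_iff hD.1).1 hcD
  have l3 : EA.le c2 u0 := le_of_le_compl hq hDs (le_trans (le_of_add' hc12) (cov_le hcov)) l2
  have ec2 : CB.J u0 c = c2 := by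
    have := J_add hsP hc12
    rw [J_of_le hsP l3, (J_zero_iff hsP).2 (le_trans l1 (le_compl_of_add hDs)), ii_zero,
      zero_add] at this
    exact (ii_inj this).symm
  obtain ⟨s0, hs0⟩ := hspec.1 c2
  have m1 : EA.le s0 s := (hs0.2 s hs).1 (by
    rw [← ec2]; exact le_trans (le_of_add hy) hxs)
  have m2 : EA.le s0 u0 := (hs0.2 u0 hsP).1 l3
  obtain ⟨z, hz, _⟩ := add_mono (le_refl D) m2 hDs
  have hzP := P_add hD.1 hs0.1 hz
  obtain ⟨c', hc', hcz⟩ := add_mono l1 (cov_le hs0) hz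
  rw [hc12] at hc'
  rw [← ii_inj hc'] at hcz
  have hqz : EA.le q z := (hcov.2 z hzP).1 hcz
  exact le_trans (add_le_cancel hDs hz hqz) m1


/-! the binary tree -/

theorem uc_step (hspec : Spectral EA CB) (a : E) (t : List Bool)
    (hcov : IsProjCover EA CB (ucAux EA CB a t).2 (ucAux EA CB a t).1) :
    IsProjCover EA CB (ucAux EA CB a (false :: t)).2 (ucAux EA CB a (false :: t)).1 ∧
    IsProjCover EA CB (ucAux EA CB a (true :: t)).2 (ucAux EA CB a (true :: t)).1 ∧
    ii EA (ucAux EA CB a (false :: t)).1 + ii EA (ucAux EA CB a (true :: t)).1 =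
      ii EA (ucAux EA CB a t).1 ∧
    ii EA (CB.J (ucAux EA CB a (false :: t)).1 (ucAux EA CB a t).2) +
      ii EA (CB.J (ucAux EA CB a (false :: t)).1 (ucAux EA CB a t).2) =
      ii EA (ucAux EA CB a (false :: t)).2 :=
  step hspec hcov rfl rfl rfl rfl

theorem uc_cov (hspec : Spectral EA CB) (a : E) (t : List Bool) :
    IsProjCover EA CB (ucAux EA CB a t).2 (ucAux EA CB a t).1 := by
  induction t with
  | nil => exact projCover_spec hspec a
  | cons b t ih =>
    cases b with
    | false => exact (uc_step hspec a t ih).1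
    | true => exact (uc_step hspec a t ih).2.1

theorem uc_split (hspec : Spectral EA CB) (a : E) (t : List Bool) :
    ii EA (ucAux EA CB a (false :: t)).1 + ii EA (ucAux EA CB a (true :: t)).1 =
      ii EA (ucAux EA CB a t).1 := (uc_step hspec a t (uc_cov hspec a t)).2.2.1

theorem J_nsmul {p : E} (hp : p ∈ CB.P) (n : ℕ) {a b : E} (h : n • ii EA a = ii EA b) :
    n • ii EA (CB.J p a) = ii EA (CB.J p b) := by
  induction n generalizing b with
  | zero =>
    rw [zero_nsmul] at *
    rw [← ii_inj (show ii EA EA.zero = ii EA b from h), J_of_le hp (zero_le _)]; rfl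
  | succ n ih =>
    rw [succ_nsmul] at *
    obtain ⟨y, _, hy, _⟩ := add_def h
    rw [ih hy]
    rw [hy] at h
    exact J_add hp h

theorem uc_zeros (hspec : Spectral EA CB) (a : E) (t : List Bool) (m : ℕ) :
    EA.le (ucAux EA CB a (List.replicate m false ++ t)).1 (ucAux EA CB a t).1 ∧
    ∀ r ∈ CB.P, EA.le r (ucAux EA CB a (List.replicate m false ++ t)).1 →
      2 ^ m • ii EA (CB.J r (ucAux EA CB a t).2) =
        ii EA (CB.J r (ucAux EA CB a (List.replicate m false ++ t)).2) := by
  induction m with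
  | zero => exact ⟨le_refl _, fun r _ _ => by simp⟩
  | succ m ih =>
    rw [List.replicate_succ, List.cons_append]
    set t' := List.replicate m false ++ t
    have h1 := uc_step hspec a t' (uc_cov hspec a t')
    have h2 : EA.le (ucAux EA CB a (false :: t')).1 (ucAux EA CB a t').1 := le_of_add h1.2.2.1
    refine ⟨le_trans h2 ih.1, ?_⟩
    intro r hr hru
    rw [pow_succ, mul_nsmul, ih.2 r hr (le_trans hru h2), two_nsmul]
    have h3 := J_add hr h1.2.2.2
    rwa [JJ_le hr h1.1.1 hru] at h3

/-- the `j`-th string of length `n`, reversed -/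
def rs : ℕ → ℕ → List Bool
  | 0, _ => []
  | n + 1, j => decide (j % 2 = 1) :: rs n (j / 2)

theorem rs_length (n j : ℕ) : (rs n j).length = n := by
  induction n generalizing j with
  | zero => rfl
  | succ n ih => simp [rs, ih]

theorem rs_even (n j : ℕ) : rs (n + 1) (2 * j) = false :: rs n j := by
  simp [rs]

theorem rs_odd (n j : ℕ) : rs (n + 1) (2 * j + 1) = true :: rs n j := by
  have : (2 * j + 1) / 2 = j := by omega
  simp [rs, this]

theorem rs_zeros (n j m : ℕ) : rs (n + m) (2 ^ m * j) = List.replicate m false ++ rs n j := by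
  induction m with
  | zero => simp
  | succ m ih =>
    rw [← add_assoc, pow_succ', mul_assoc, rs_even, ih]; rfl

theorem range_two_mul (m : ℕ) :
    List.range (2 * m) = (List.range m).flatMap fun j => [2 * j, 2 * j + 1] := by
  induction m with
  | zero => rfl
  | succ m ih =>
    rw [List.range_succ (n := m), List.flatMap_append, ← ih, mul_add, mul_one,
      show 2 * m + 2 = 2 * m + 1 + 1 from rfl, List.range_succ, List.range_succ]
    simp

theorem allStrings_eq (n : ℕ) :
    allStrings n = (List.range (2 ^ n)).map fun j => (rs n j).reverse := by
  induction n with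
  | zero => rfl
  | succ n ih =>
    rw [allStrings, ih, pow_succ', range_two_mul, List.map_flatMap, List.flatMap_map]
    congr 1
    funext j
    simp [rs_even, rs_odd]

theorem lamOf_append (w : List Bool) (b : Bool) :
    lamOf (w ++ [b]) = lamOf w + (if b then 1 else 0) / 2 ^ (w.length + 1) := by
  induction w with
  | nil => simp [lamOf]
  | cons c t ih =>
    rw [List.cons_append, lamOf, ih, lamOf, List.length_cons, pow_succ (2 : ℚ) (t.length + 1)]
    field_simp
    ring

theorem lamOf_rs (n j : ℕ) (h : j < 2 ^ n) : lamOf (rs n j).reverse = (j : ℚ) / 2 ^ n := by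
  induction n generalizing j with
  | zero =>
    have : j = 0 := by simpa using h
    subst this; simp [rs, lamOf]
  | succ n ih =>
    rw [pow_succ] at h
    rw [rs, List.reverse_cons, lamOf_append, ih _ (by omega), List.length_reverse, rs_length]
    have e : (j : ℚ) = 2 * ((j / 2 : ℕ) : ℚ) + ((j % 2 : ℕ) : ℚ) := by
      exact_mod_cast (Nat.div_add_mod j 2).symm
    rcases Nat.mod_two_eq_zero_or_one j with h0 | h0
    · rw [h0] at e
      simp only [h0]
      rw [e, pow_succ]; field_simp; simp
    · rw [h0] at e
      simp only [h0]
      rw [e, pow_succ]; field_simp; simp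

theorem lamOf_exists (w : List Bool) :
    ∃ j : ℕ, j < 2 ^ w.length ∧ lamOf w = (j : ℚ) / 2 ^ w.length := by
  induction w with
  | nil => exact ⟨0, by simp, by simp [lamOf]⟩
  | cons b t ih =>
    obtain ⟨j, hj, he⟩ := ih
    refine ⟨(if b then 2 ^ t.length else 0) + j, ?_, ?_⟩
    · rw [List.length_cons, pow_succ]
      split_ifs <;> omega
    · rw [lamOf, he, List.length_cons, pow_succ]
      split_ifs
      · push_cast; field_simp
      · push_cast; field_simp; ring

theorem word_exists (n k : ℕ) (h0 : 0 < k) (h1 : k < 2 ^ n) :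
    ∃ w : List Bool, lamOf (w ++ [true]) = (k : ℚ) / 2 ^ n := by
  induction n generalizing k with
  | zero => simp at h1; omega
  | succ n ih =>
    rw [pow_succ] at h1
    rcases Nat.even_or_odd' k with ⟨j, rfl | rfl⟩
    · obtain ⟨w, hw⟩ := ih j (by omega) (by omega)
      refine ⟨w, ?_⟩
      rw [hw, pow_succ]; push_cast; field_simp
    · refine ⟨(rs n j).reverse, ?_⟩
      rw [lamOf_append, lamOf_rs n j (by omega), List.length_reverse, rs_length, pow_succ]
      push_cast; field_simp; simp

theorem foldl_oplus (l : List E) (acc r : E) (h : ii EA acc + (l.map (ii EA)).sum = ii EA r) :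
    l.foldl (fun acc x => EA.oplusD acc x) acc = r := by
  induction l generalizing acc with
  | nil =>
    simp only [List.map_nil, List.sum_nil, add_zero] at h
    exact ii_inj h
  | cons x t ih =>
    rw [List.map_cons, List.sum_cons, ← add_assoc] at h
    obtain ⟨y, _, hy, _⟩ := add_def h
    rw [List.foldl_cons, oplusD_eq hy]
    apply ih
    rw [← hy]; exact h

noncomputable def UU (CB : CompressionBase EA) (a : E) (n j : ℕ) : E :=
  (ucAux EA CB a (rs n j)).1

noncomputable def VV (CB : CompressionBase EA) (a : E) (n k : ℕ) : OE EA :=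
  ∑ j ∈ Finset.range k, ii EA (UU CB a n j)

theorem VV_double (hspec : Spectral EA CB) (a : E) (n k : ℕ) :
    VV CB a (n + 1) (2 * k) = VV CB a n k := by
  unfold VV
  induction k with
  | zero => rfl
  | succ k ih =>
    rw [mul_add, mul_one, Finset.sum_range_succ, Finset.sum_range_succ, ih,
      Finset.sum_range_succ, add_assoc]
    congr 1
    unfold UU
    rw [rs_even, rs_odd]
    exact uc_split hspec a _

theorem VV_pow (hspec : Spectral EA CB) (a : E) (n k m : ℕ) :
    VV CB a (n + m) (2 ^ m * k) = VV CB a n k := by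
  induction m with
  | zero => simp
  | succ m ih => rw [← add_assoc, pow_succ', mul_assoc, VV_double hspec, ih]

theorem VV_congr (hspec : Spectral EA CB) (a : E) {n k n' k' : ℕ}
    (h : (k : ℚ) / 2 ^ n = (k' : ℚ) / 2 ^ n') : VV CB a n k = VV CB a n' k' := by
  rw [← VV_pow hspec a n k n', ← VV_pow hspec a n' k' n, add_comm n' n]
  congr 1
  rw [div_eq_div_iff (by positivity) (by positivity)] at h
  have : k * 2 ^ n' = k' * 2 ^ n := by exact_mod_cast h
  rw [mul_comm, this, mul_comm]

theorem VV_full (hspec : Spectral EA CB) (a : E) (n : ℕ) :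
    VV CB a n (2 ^ n) = ii EA (projCover EA CB a) := by
  have := VV_pow hspec a 0 1 n
  rw [zero_add, mul_one] at this
  rw [this]
  simp [VV, UU, rs, ucAux]

theorem VV_add (a : E) (n k t : ℕ) :
    ∃ x, VV CB a n (k + t) = VV CB a n k + x := ⟨_, Finset.sum_range_add _ k t⟩

theorem VV_total (hspec : Spectral EA CB) (a : E) {n k : ℕ} (hk : k ≤ 2 ^ n) :
    ∃ x, ii EA (EA.compl (projCover EA CB a)) + VV CB a n k + x = ii EA EA.one := by
  obtain ⟨t, ht⟩ := Nat.exists_eq_add_of_le hk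
  obtain ⟨x, hx⟩ := VV_add (CB := CB) a n k t
  refine ⟨x, ?_⟩
  rw [add_assoc, ← hx, ← ht, VV_full hspec, add_comm, compl_add]

theorem VV_P (hspec : Spectral EA CB) (a : E) {n k : ℕ} (hk : k ≤ 2 ^ n) :
    ∃ s ∈ CB.P, ii EA (EA.compl (projCover EA CB a)) + VV CB a n k = ii EA s := by
  induction k with
  | zero =>
    refine ⟨_, P_compl (projCover_spec hspec a).1, ?_⟩
    simp [VV]
  | succ k ih =>
    obtain ⟨s, hs, he⟩ := ih (by omega)
    obtain ⟨x, hx⟩ := VV_total (CB := CB) hspec a hk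
    obtain ⟨r, _, hr, _⟩ := add_def hx
    refine ⟨r, ?_, hr⟩
    have : ii EA s + ii EA (UU CB a n k) = ii EA r := by
      rw [← hr, ← he, VV, VV, Finset.sum_range_succ, add_assoc]
    exact P_add hs (uc_cov hspec a _).1 this

theorem sum_list_range (f : ℕ → OE EA) (k : ℕ) :
    ((List.range k).map f).sum = ∑ j ∈ Finset.range k, f j := by
  induction k with
  | zero => rfl
  | succ k ih => rw [List.range_succ, Finset.sum_range_succ, ← ih]; simp

theorem filter_range (k M : ℕ) (h : k ≤ M) (f : ℕ → Bool) (hf : ∀ j < M, f j = decide (j < k)) :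
    (List.range M).filter f = List.range k := by
  obtain ⟨t, rfl⟩ := Nat.exists_eq_add_of_le h
  rw [List.range_add, List.filter_append, List.filter_eq_self.2, List.filter_eq_nil_iff.2,
    List.append_nil]
  · intro x hx
    simp only [List.mem_map, List.mem_range] at hx
    obtain ⟨y, hy, rfl⟩ := hx
    rw [hf _ (by omega)]; simp
  · intro x hx
    rw [List.mem_range] at hx
    rw [hf _ (by omega)]; simpa using hx

theorem pbin_eq (hspec : Spectral EA CB) (a : E) (w : List Bool) :
    ∃ n k : ℕ, lamOf (w ++ [true]) = (k : ℚ) / 2 ^ n ∧ k ≤ 2 ^ n ∧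
      ii EA (pbin EA CB a w) = ii EA (EA.compl (projCover EA CB a)) + VV CB a n k := by
  obtain ⟨j, hj, he⟩ := lamOf_exists w
  have hk : 2 * j + 1 ≤ 2 ^ (w.length + 1) := by rw [pow_succ]; omega
  refine ⟨w.length + 1, 2 * j + 1, ?_, hk, ?_⟩
  · rw [lamOf_append, he, pow_succ]; push_cast; field_simp; simp
  · obtain ⟨r, hrP, hr⟩ := VV_P (CB := CB) hspec a hk
    rw [hr]
    congr 1
    unfold pbin listSum
    apply foldl_oplus
    rw [ii_zero, zero_add, List.map_cons, List.sum_cons, ← hr]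
    congr 1
    rw [allStrings_eq, List.filter_map, filter_range (2 * j + 1) _ hk]
    · rw [List.map_map, List.map_map, VV, sum_list_range]
      apply Finset.sum_congr rfl
      intro i _
      simp [uw, UU]
    · intro i hi
      simp only [Function.comp_apply]
      rw [decide_eq_decide, lamOf_rs _ _ hi, lamOf_append, he, pow_succ]
      have : ((i : ℚ) / (2 ^ w.length * 2) ≤ (j : ℚ) / 2 ^ w.length
        + (if false = true then 1 else 0) / (2 ^ w.length * 2)) ↔ (i : ℚ) ≤ 2 * j := by
        simp only [Bool.false_eq_true, if_false, zero_div, add_zero]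
        rw [div_le_div_iff₀ (by positivity) (by positivity)]
        constructor
        · intro h
          have hp : (0 : ℚ) < 2 ^ w.length := by positivity
          nlinarith
        · intro h
          have hp : (0 : ℚ) < 2 ^ w.length := by positivity
          nlinarith
      rw [this, Nat.lt_succ_iff]
      norm_cast

theorem pdyad_eq (hspec : Spectral EA CB) (a : E) {n k : ℕ} (hk : k ≤ 2 ^ n) :
    ii EA (pdyad EA CB a ((k : ℚ) / 2 ^ n)) =
      ii EA (EA.compl (projCover EA CB a)) + VV CB a n k := by
  unfold pdyad
  rcases Nat.eq_zero_or_pos k with rfl | h0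
  · simp [VV]
  have hpos : (0 : ℚ) < (k : ℚ) / 2 ^ n := by positivity
  rw [if_neg (not_le.2 hpos)]
  rcases Nat.eq_or_lt_of_le hk with rfl | h1
  · rw [if_pos, VV_full hspec, add_comm, compl_add]
    push_cast; rw [div_self]; positivity
  have hlt : (k : ℚ) / 2 ^ n < 1 := by
    rw [div_lt_one (by positivity)]; exact_mod_cast h1
  rw [if_neg (not_le.2 hlt)]
  have hex := word_exists n k h0 h1
  rw [dif_pos hex]
  obtain ⟨n', k', e1, hk', e2⟩ := pbin_eq (CB := CB) hspec a hex.choose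
  rw [e2, VV_congr hspec a (e1.symm.trans hex.choose_spec)]


theorem pdyad_mono (hspec : Spectral EA CB) (a : E) {n k n' k' : ℕ} (hk : k ≤ 2 ^ n)
    (hk' : k' ≤ 2 ^ n') (h : (k : ℚ) / 2 ^ n ≤ (k' : ℚ) / 2 ^ n') :
    EA.le (pdyad EA CB a ((k : ℚ) / 2 ^ n)) (pdyad EA CB a ((k' : ℚ) / 2 ^ n')) := by
  rw [le_iff, pdyad_eq hspec a hk, pdyad_eq hspec a hk', ← VV_pow hspec a n k n',
    ← VV_pow hspec a n' k' n, add_comm n' n]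
  rw [div_le_div_iff₀ (by positivity) (by positivity)] at h
  have h2 : k * 2 ^ n' ≤ k' * 2 ^ n := by exact_mod_cast h
  obtain ⟨t, ht⟩ := Nat.exists_eq_add_of_le h2
  obtain ⟨x, hx⟩ := VV_add (CB := CB) a (n + n') (k * 2 ^ n') t
  refine ⟨x, ?_⟩
  rw [mul_comm (2 ^ n), ht, hx, mul_comm (2 ^ n'), add_assoc]

theorem forward (hspec : Spectral EA CB)
    (H : ∀ a : E, IsInfP EA CB {y | ∃ μ : ℚ, Dyadic01 μ ∧ 0 < μ ∧ y = pdyad EA CB a μ}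
        (pdyad EA CB a 0)) : EA.ArchimedeanEA := by
  intro a ha
  have ha' : ∀ n : ℕ, ∃ b, n • ii EA a = ii EA b := by
    intro n
    obtain ⟨b, hb⟩ := ha n
    rw [nsmulE_eq] at hb
    exact ⟨b, hb⟩
  have hA := projCover_spec hspec a
  have key : ∀ m : ℕ, (ucAux EA CB a (List.replicate m false)).1 = projCover EA CB a ∧
      2 ^ m • ii EA a = ii EA (ucAux EA CB a (List.replicate m false)).2 := by
    intro m
    induction m with
    | zero => exact ⟨rfl, by simp [ucAux]⟩
    | succ m ih =>
      rw [List.replicate_succ]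
      obtain ⟨ih1, ih2⟩ := ih
      have hst := uc_step hspec a (List.replicate m false) (uc_cov hspec a _)
      have hcv := uc_cov hspec a (List.replicate m false)
      set q := (ucAux EA CB a (List.replicate m false)).1 with hqdef
      set y := (ucAux EA CB a (List.replicate m false)).2 with hydef
      have hq : q ∈ CB.P := hcv.1
      have hyq := cov_le hcv
      obtain ⟨z, hz⟩ := ha' (2 ^ (m + 1))
      have hz2 : ii EA y + ii EA y = ii EA z := by
        rw [← hz, pow_succ, mul_nsmul, ih2, two_nsmul]
      have hzq : EA.le z q := principal hq hyq hyq hz2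
      have he := osub_spec hyq
      have hye : EA.le y (EA.osub q y) := add_le_cancel hz2 he hzq
      have hd : posPartq EA CB q (EA.osub q y) y = EA.zero := by
        obtain ⟨h, hh, hdd⟩ := posPartq_spec hspec hq he
        have e1 : CB.J h y = CB.J h (EA.osub q y) :=
          le_antisymm (J_mono hh.1.1.1 hye) hh.2.1
        rw [e1] at hdd
        exact ii_inj (cancel hdd (by rw [ii_zero, add_zero]))
      have hc : projCoverq EA CB q EA.zero = EA.zero := by
        apply le_zero
        exact ((projCoverq_spec hspec hq (zero_le q)).2 EA.zero P_zero).1 (le_refl _)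
      have hu : (ucAux EA CB a (false :: List.replicate m false)).1 = q := by
        show pmeet EA CB (EA.osub q (projCoverq EA CB q
          (posPartq EA CB q (EA.osub q y) y))) q = q
        rw [hd, hc, osub_eq (show ii EA EA.zero + ii EA q = ii EA q by rw [ii_zero, zero_add])]
        exact pmeet_eq ⟨hq, le_refl _, le_refl _, fun s _ h _ => h⟩
      refine ⟨hu.trans ih1, ?_⟩
      have h4 := hst.2.2.2
      rw [hu, J_of_le hq hyq] at h4
      rw [← h4, pow_succ, mul_nsmul, ih2, two_nsmul]
  have hone : ∀ m : ℕ, pdyad EA CB a (((1 : ℕ) : ℚ) / 2 ^ m) = EA.one := by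
    intro m
    apply ii_inj (EA := EA)
    rw [pdyad_eq hspec a Nat.one_le_two_pow]
    have : rs m 0 = List.replicate m false := by
      have := rs_zeros 0 0 m
      simpa [rs] using this
    simp only [VV, UU, Finset.sum_range_one, this, (key m).1]
    rw [add_comm, compl_add]
  have h1 : EA.le EA.one (pdyad EA CB a 0) := by
    apply (H a).2.2 EA.one CB.sub.2.1
    rintro y ⟨μ, ⟨n, k, hk, rfl⟩, hpos, rfl⟩
    have hk' : k ≤ 2 ^ n := by exact_mod_cast hk
    have hk0 : 1 ≤ k := by
      rcases Nat.eq_zero_or_pos k with rfl | h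
      · simp at hpos
      · exact h
    have := pdyad_mono hspec a (Nat.one_le_two_pow (n := n)) hk' (n := n) (k := 1)
      (by gcongr)
    rwa [hone] at this
  have h2 : pdyad EA CB a 0 = EA.compl (projCover EA CB a) := by simp [pdyad]
  rw [h2] at h1
  have h3 := le_self_compl hA.1 (le_trans (le_one _) h1)
  have h4 := cov_le hA
  rw [h3] at h4
  exact le_zero h4

theorem backward (hspec : Spectral EA CB) (harch : EA.ArchimedeanEA) (a : E) {n k : ℕ}
    (hk : k < 2 ^ n) {t : E} (ht : t ∈ CB.P)
    (H : ∀ y ∈ {y | ∃ μ : ℚ, Dyadic01 μ ∧ (k : ℚ) / 2 ^ n < μ ∧ y = pdyad EA CB a μ},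
      EA.le t y) : EA.le t (pdyad EA CB a ((k : ℚ) / 2 ^ n)) := by
  obtain ⟨p, hp, hpe⟩ := VV_P (CB := CB) hspec a hk.le
  have e0 : pdyad EA CB a ((k : ℚ) / 2 ^ n) = p := by
    apply ii_inj (EA := EA)
    rw [pdyad_eq hspec a hk.le, hpe]
  rw [e0]
  have hp' := P_compl hp
  set x := CB.J (EA.compl p) t with hx
  have hxm : ∀ m : ℕ, EA.le x (ucAux EA CB a (List.replicate m false ++ rs n k)).1 := by
    intro m
    have hb : 2 ^ m * k + 1 ≤ 2 ^ (n + m) := by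
      rw [pow_add, mul_comm]
      exact Nat.succ_le_of_lt (Nat.mul_lt_mul_of_pos_right hk (by positivity))
    have hle := H _ ⟨((2 ^ m * k + 1 : ℕ) : ℚ) / 2 ^ (n + m), ⟨n + m, _, by exact_mod_cast hb, rfl⟩,
      by
        rw [div_lt_div_iff₀ (by positivity) (by positivity), pow_add]
        push_cast
        have : (0 : ℚ) < 2 ^ n := by positivity
        nlinarith, rfl⟩
    have e1 := pdyad_eq (CB := CB) hspec a hb
    rw [VV, Finset.sum_range_succ, ← VV, VV_pow hspec, ← add_assoc, hpe, UU, rs_zeros] at e1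
    set u := (ucAux EA CB a (List.replicate m false ++ rs n k)).1
    have h1 := J_mono hp' hle
    have h2 := J_add hp' e1.symm
    rw [(J_zero_iff hp').2 (by rw [compl_compl]; exact le_refl p), ii_zero, zero_add,
      J_of_le hp' (le_compl_of_add' e1.symm)] at h2
    rwa [← ii_inj h2] at h1
  obtain ⟨r, hr⟩ := hspec.1 x
  have hru : ∀ m : ℕ, EA.le r (ucAux EA CB a (List.replicate m false ++ rs n k)).1 :=
    fun m => (hr.2 _ (uc_cov hspec a _).1).1 (hxm m)
  have hJ : CB.J r (ucAux EA CB a (rs n k)).2 = EA.zero := by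
    apply harch
    intro N
    have h1 := (uc_zeros hspec a (rs n k) N).2 r hr.1 (hru N)
    obtain ⟨b, hb⟩ := nsmul_def_of_le (Nat.lt_two_pow_self (n := N)).le h1
    exact ⟨b, by rw [nsmulE_eq, hb]; rfl⟩
  have hcov := uc_cov hspec a (rs n k)
  have h1 := (hcov.2 _ (P_compl hr.1)).1 ((J_zero_iff hr.1).1 hJ)
  have h2 := hru 0
  rw [List.replicate_zero, List.nil_append] at h2
  have h3 := le_self_compl hr.1 (le_trans h2 h1)
  have h4 := cov_le hr
  rw [h3] at h4
  have h5 := (J_zero_iff hp').1 (le_zero h4)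
  rwa [compl_compl] at h5

end
end SP

open EffectAlgebra in
/-- in a spectral effect algebra `E`, the binary spectral resolution of
every element is right continuous (`p_{a,λ} = ⋀_{μ>λ} p_{a,μ}` over dyadic `μ`, for
every dyadic `λ ∈ [0,1)`) if and only if `E` is archimedean. -/
theorem statement12 {E : Type u} (EA : EffectAlgebra E) (CB : CompressionBase EA)
    (hspec : Spectral EA CB) :
    (∀ a : E, ∀ lam : ℚ, Dyadic01 lam → lam < 1 →
      IsInfP EA CB {y | ∃ μ : ℚ, Dyadic01 μ ∧ lam < μ ∧ y = pdyad EA CB a μ}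
        (pdyad EA CB a lam)) ↔
      EA.ArchimedeanEA := by
  constructor
  · intro H
    apply SP.forward hspec
    intro a
    exact H a 0 ⟨0, 0, by norm_num, by norm_num⟩ (by norm_num)
  · intro harch a lam hlam hlt
    obtain ⟨n, k, hk, rfl⟩ := hlam
    have hk' : k < 2 ^ n := by
      rw [div_lt_one (by positivity)] at hlt
      exact_mod_cast hlt
    refine ⟨?_, ?_, ?_⟩
    · obtain ⟨p, hp, hpe⟩ := SP.VV_P (CB := CB) hspec a hk'.le
      have e0 : pdyad EA CB a ((k : ℚ) / 2 ^ n) = p := by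
        apply SP.ii_inj (EA := EA)
        rw [SP.pdyad_eq hspec a hk'.le, hpe]
      rw [e0]; exact hp
    · rintro y ⟨μ, ⟨n', k1, hk1, rfl⟩, hl, rfl⟩
      exact SP.pdyad_mono hspec a hk'.le (by exact_mod_cast hk1) hl.le
    · intro t ht H
      exact SP.backward hspec harch a hk' ht H
end
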